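/- Let f and f' be nonzero homogeneous polynomials of degree 3 in four variables over ℝ, each defining a smooth cubic surface. If the set of lines on V(f) defined over ℝ and the set of lines on V(f') defined over ℝ have the same (finite) cardinality, then there is a bijection σ from the lines of V(f) to the lines of V(f') such that for all lines W₁, W₂ on V(f), W₁ ∩ W₂ ≠ {0} if and only if σ(W₁) ∩ σ(W₂) ≠ {0}. That is, any two real smooth cubic surfaces with the same number of real lines have isomorphic intersection graphs. -/

import Mathlib

open MvPolynomial

/-- The restriction of `f` to the line spanned by `v` and `w`:
the polynomial `f (s • v + t • w)` in the two variables `s, t`. -/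
noncomputable def lineRestrict {k : Type*} [CommRing k] (f : MvPolynomial (Fin 4) k)
    (v w : Fin 4 → k) : MvPolynomial (Fin 2) k :=
  aeval (fun i => C (v i) * X 0 + C (w i) * X 1) f

/-- `W` is a line on the cubic surface `V(f)` defined over `k`: a 2-dimensional
`k`-linear subspace of `k⁴` on which `f` vanishes identically as a polynomial. -/
def IsLineOn {k : Type*} [Field k] (f : MvPolynomial (Fin 4) k)
    (W : Submodule k (Fin 4 → k)) : Prop :=
  Module.finrank k W = 2 ∧
    ∃ v w : Fin 4 → k, Submodule.span k {v, w} = W ∧ lineRestrict f v w = 0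

/-- `f` defines a smooth cubic surface over `k`: `f` is a nonzero homogeneous cubic
and, over an algebraic closure, the only common zero of `f` and its partial
derivatives is the origin. -/
def IsSmoothCubic (k : Type*) [Field k] (f : MvPolynomial (Fin 4) k) : Prop :=
  f ≠ 0 ∧ f.IsHomogeneous 3 ∧
    ∀ x : Fin 4 → AlgebraicClosure k,
      (eval x (map (algebraMap k (AlgebraicClosure k)) f) = 0 ∧
        ∀ i : Fin 4, eval x (map (algebraMap k (AlgebraicClosure k)) (pderiv i f)) = 0) →
      x = 0

section LineGraph

/-- Three pairwise adjacent vertices such that every other vertex is adjacent to exactly one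
of them. -/
structure IsTritangent {L : Type*} (G : SimpleGraph L) (a b c : L) : Prop where
  adj₁₂ : G.Adj a b
  adj₁₃ : G.Adj a c
  adj₂₃ : G.Adj b c
  existsUnique : ∀ d, d ≠ a → d ≠ b → d ≠ c →
    (G.Adj d a ∧ ¬G.Adj d b ∧ ¬G.Adj d c) ∨ (¬G.Adj d a ∧ G.Adj d b ∧ ¬G.Adj d c) ∨
      (¬G.Adj d a ∧ ¬G.Adj d b ∧ G.Adj d c)

namespace IsTritangent

variable {L : Type*} {G : SimpleGraph L} {a b c d : L}

theorem swap₁₂ (h : IsTritangent G a b c) : IsTritangent G b a c where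
  adj₁₂ := h.adj₁₂.symm
  adj₁₃ := h.adj₂₃
  adj₂₃ := h.adj₁₃
  existsUnique d hb ha hc := by have := h.existsUnique d ha hb hc; tauto

theorem swap₂₃ (h : IsTritangent G a b c) : IsTritangent G a c b where
  adj₁₂ := h.adj₁₃
  adj₁₃ := h.adj₁₂
  adj₂₃ := h.adj₂₃.symm
  existsUnique d ha hc hb := by have := h.existsUnique d ha hb hc; tauto

theorem eq_of_adj (h : IsTritangent G a b c) (ha : G.Adj d a) (hb : G.Adj d b) : d = c := by
  by_contra hc
  have := h.existsUnique d ha.ne hb.ne hc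
  tauto

theorem not_adj (h : IsTritangent G a b c) (ha : G.Adj d a) (hc : d ≠ c) : ¬G.Adj d b :=
  fun hb => hc (h.eq_of_adj ha hb)

theorem adj_of_not_adj (h : IsTritangent G a b c) (ha : d ≠ a) (hb : d ≠ b)
    (ha' : ¬G.Adj d a) (hb' : ¬G.Adj d b) : G.Adj d c := by
  by_cases hc : d = c
  · subst hc; exact absurd h.adj₁₃.symm ha'
  · have := h.existsUnique d ha hb hc
    tauto

end IsTritangent

/-- Labelled vertices built from two disjoint lines `x`, `y`: the common neighbours `c i`, and the
third lines in the resulting tritangent planes. -/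
structure Labelling {L : Type*} (G : SimpleGraph L) (n : ℕ) where
  x : L
  y : L
  a : Fin n → L
  b : Fin n → L
  c : Fin n → L
  d : Fin n → Fin n → L
  x_ne_y : x ≠ y
  not_adj_xy : ¬G.Adj x y
  c_injective : Function.Injective c
  adj_c : ∀ v, G.Adj x v → G.Adj y v → ∃ i, v = c i
  tri_a : ∀ i, IsTritangent G x (c i) (a i)
  tri_b : ∀ i, IsTritangent G y (c i) (b i)
  tri_d : ∀ i j, i ≠ j → IsTritangent G (a i) (b j) (d i j)

namespace Labelling

variable {L : Type*} {G : SimpleGraph L} {n : ℕ} (l : Labelling G n) {i j k m : Fin n} {v : L}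

theorem adj_xc (i) : G.Adj l.x (l.c i) := (l.tri_a i).adj₁₂
theorem adj_xa (i) : G.Adj l.x (l.a i) := (l.tri_a i).adj₁₃
theorem adj_ca (i) : G.Adj (l.c i) (l.a i) := (l.tri_a i).adj₂₃
theorem adj_yc (i) : G.Adj l.y (l.c i) := (l.tri_b i).adj₁₂
theorem adj_yb (i) : G.Adj l.y (l.b i) := (l.tri_b i).adj₁₃
theorem adj_cb (i) : G.Adj (l.c i) (l.b i) := (l.tri_b i).adj₂₃

theorem not_adj_ya (i) : ¬G.Adj l.y (l.a i) :=
  (l.tri_a i).swap₁₂.swap₂₃.not_adj (l.adj_yc i) l.x_ne_y.symm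

theorem not_adj_xb (i) : ¬G.Adj l.x (l.b i) :=
  (l.tri_b i).swap₁₂.swap₂₃.not_adj (l.adj_xc i) l.x_ne_y

theorem not_adj_cc (i j) : ¬G.Adj (l.c i) (l.c j) := fun h => by
  have h1 := (l.tri_a j).eq_of_adj (l.adj_xc i).symm h
  exact l.not_adj_ya j (h1 ▸ l.adj_yc i)

theorem not_adj_ca (h : i ≠ j) : ¬G.Adj (l.c i) (l.a j) := fun h' =>
  h (l.c_injective ((l.tri_a j).swap₂₃.eq_of_adj (l.adj_xc i).symm h'))

theorem not_adj_cb (h : i ≠ j) : ¬G.Adj (l.c i) (l.b j) := fun h' =>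
  h (l.c_injective ((l.tri_b j).swap₂₃.eq_of_adj (l.adj_yc i).symm h'))

theorem not_adj_aa (i j) : ¬G.Adj (l.a i) (l.a j) := fun h => by
  have h1 := (l.tri_a j).swap₂₃.eq_of_adj (l.adj_xa i).symm h
  exact l.not_adj_ya i (h1 ▸ l.adj_yc j)

theorem not_adj_bb (i j) : ¬G.Adj (l.b i) (l.b j) := fun h => by
  have h1 := (l.tri_b j).swap₂₃.eq_of_adj (l.adj_yb i).symm h
  exact l.not_adj_xb i (h1 ▸ l.adj_xc j)

theorem a_ne_y (i) : l.a i ≠ l.y := fun h => l.not_adj_xy (h ▸ l.adj_xa i)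
theorem b_ne_x (i) : l.b i ≠ l.x := fun h => l.not_adj_xy (h ▸ l.adj_yb i).symm
theorem a_ne_c (i j) : l.a i ≠ l.c j := fun h => l.not_adj_ya i (h ▸ l.adj_yc j)
theorem b_ne_c (i j) : l.b i ≠ l.c j := fun h => l.not_adj_xb i (h ▸ l.adj_xc j)
theorem a_ne_b (i j) : l.a i ≠ l.b j := fun h => l.not_adj_xb j (h ▸ l.adj_xa i)

theorem adj_ab (h : i ≠ j) : G.Adj (l.a i) (l.b j) :=
  (l.tri_b j).adj_of_not_adj (l.a_ne_y i) (l.a_ne_c i j) (fun h' => l.not_adj_ya i h'.symm)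
    (fun h' => l.not_adj_ca h.symm h'.symm)

theorem not_adj_ab (i) : ¬G.Adj (l.a i) (l.b i) :=
  (l.tri_b i).swap₁₂.swap₂₃.not_adj (l.adj_ca i).symm (l.a_ne_y i)

theorem adj_ad (h : i ≠ j) : G.Adj (l.a i) (l.d i j) := (l.tri_d i j h).adj₁₃
theorem adj_bd (h : i ≠ j) : G.Adj (l.b j) (l.d i j) := (l.tri_d i j h).adj₂₃

theorem not_adj_xd (h : i ≠ j) : ¬G.Adj l.x (l.d i j) :=
  (l.tri_d i j h).swap₂₃.not_adj (l.adj_xa i) (l.b_ne_x j).symm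

theorem not_adj_yd (h : i ≠ j) : ¬G.Adj l.y (l.d i j) :=
  (l.tri_d i j h).swap₁₂.swap₂₃.not_adj (l.adj_yb j) (l.a_ne_y i).symm

theorem a_ne_d (h : i ≠ j) (k) : l.a k ≠ l.d i j := fun e => l.not_adj_xd h (e ▸ l.adj_xa k)
theorem b_ne_d (h : i ≠ j) (k) : l.b k ≠ l.d i j := fun e => l.not_adj_yd h (e ▸ l.adj_yb k)
theorem c_ne_d (h : i ≠ j) (k) : l.c k ≠ l.d i j := fun e => l.not_adj_xd h (e ▸ l.adj_xc k)

theorem d_symm (h : i ≠ j) : l.d i j = l.d j i := by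
  have h1 : G.Adj (l.a j) (l.d i j) := (l.tri_d i j h).adj_of_not_adj
    (fun e => l.not_adj_ab j (e ▸ l.adj_ab h)) (l.a_ne_b j j) (l.not_adj_aa j i) (l.not_adj_ab j)
  have h2 : G.Adj (l.b i) (l.d i j) := (l.tri_d i j h).adj_of_not_adj
    (l.a_ne_b i i).symm (fun e => l.not_adj_ab i (e ▸ l.adj_ab h))
    (fun e => l.not_adj_ab i e.symm) (l.not_adj_bb i j)
  exact (l.tri_d j i h.symm).eq_of_adj h1.symm h2.symm

theorem a_injective : Function.Injective l.a := fun i j e => by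
  by_contra h
  exact l.not_adj_ab j (e ▸ l.adj_ab h)

theorem b_injective : Function.Injective l.b := fun i j e => by
  by_contra h
  exact l.not_adj_ab i (e ▸ l.adj_ab h)

theorem adj_ad' (h : i ≠ j) : G.Adj (l.a j) (l.d i j) := l.d_symm h ▸ l.adj_ad h.symm
theorem adj_bd' (h : i ≠ j) : G.Adj (l.b i) (l.d i j) := l.d_symm h ▸ l.adj_bd h.symm

theorem not_adj_ad (h : i ≠ j) (hi : k ≠ i) (hj : k ≠ j) : ¬G.Adj (l.a k) (l.d i j) :=
  (l.tri_d i j h).swap₁₂.swap₂₃.not_adj (l.adj_ab hj) fun e => hi (l.a_injective e)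

theorem not_adj_bd (h : i ≠ j) (hi : k ≠ i) (hj : k ≠ j) : ¬G.Adj (l.b k) (l.d i j) :=
  (l.tri_d i j h).swap₂₃.not_adj (l.adj_ab hi.symm).symm fun e => hj (l.b_injective e)

theorem adj_cd (h : i ≠ j) (hi : k ≠ i) (hj : k ≠ j) : G.Adj (l.c k) (l.d i j) :=
  (l.tri_d i j h).adj_of_not_adj (l.a_ne_c i k).symm (l.b_ne_c j k).symm (l.not_adj_ca hi)
    (l.not_adj_cb hj)

theorem not_adj_cd (h : i ≠ j) : ¬G.Adj (l.c i) (l.d i j) :=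
  (l.tri_d i j h).swap₂₃.not_adj (l.adj_ca i) (l.b_ne_c j i).symm

theorem not_adj_cd' (h : i ≠ j) : ¬G.Adj (l.c j) (l.d i j) :=
  l.d_symm h ▸ l.not_adj_cd h.symm

theorem d_ne_d (h : i ≠ j) (h' : k ≠ m) (hi : i ≠ k) (hi' : i ≠ m) : l.d i j ≠ l.d k m := fun e =>
  l.not_adj_ad h' hi hi' (e ▸ l.adj_ad h)

theorem adj_dd (h : i ≠ j) (h' : k ≠ m) (hik : i ≠ k) (him : i ≠ m) (hjk : j ≠ k) (hjm : j ≠ m) :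
    G.Adj (l.d i j) (l.d k m) :=
  (l.tri_d k m h').adj_of_not_adj (l.a_ne_d h k).symm (l.b_ne_d h m).symm
    (fun e => l.not_adj_ad h hik.symm hjk.symm e.symm)
    (fun e => l.not_adj_bd h him.symm hjm.symm e.symm)

theorem not_adj_dd (h : i ≠ j) (h' : i ≠ k) : ¬G.Adj (l.d i j) (l.d i k) :=
  (l.tri_d i k h').swap₂₃.not_adj (l.adj_ad h).symm (l.b_ne_d h k).symm

/-- A vertex meeting all the `c i` and neither `x` nor `y`. -/
structure IsExtra (v : L) : Prop where
  ne_x : v ≠ l.x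
  ne_y : v ≠ l.y
  not_adj_x : ¬G.Adj v l.x
  not_adj_y : ¬G.Adj v l.y
  adj_c : ∀ i, G.Adj v (l.c i)

variable {l}

theorem IsExtra.not_adj_a (h : l.IsExtra v) (i) : ¬G.Adj v (l.a i) :=
  (l.tri_a i).swap₁₂.swap₂₃.not_adj (h.adj_c i) h.ne_x

theorem IsExtra.not_adj_b (h : l.IsExtra v) (i) : ¬G.Adj v (l.b i) :=
  (l.tri_b i).swap₁₂.swap₂₃.not_adj (h.adj_c i) h.ne_y

theorem IsExtra.ne_a (h : l.IsExtra v) (i) : v ≠ l.a i := fun e =>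
  h.not_adj_x (e ▸ (l.adj_xa i).symm)

theorem IsExtra.ne_b (h : l.IsExtra v) (i) : v ≠ l.b i := fun e =>
  h.not_adj_y (e ▸ (l.adj_yb i).symm)

theorem IsExtra.ne_c (h : l.IsExtra v) (i) : v ≠ l.c i := fun e =>
  h.not_adj_x (e ▸ (l.adj_xc i).symm)

theorem IsExtra.adj_d (h : l.IsExtra v) (hij : i ≠ j) : G.Adj v (l.d i j) :=
  (l.tri_d i j hij).adj_of_not_adj (h.ne_a i) (h.ne_b j) (h.not_adj_a i) (h.not_adj_b j)

variable (l)

theorem eq_of_adj_x (H : ∀ a b, G.Adj a b → ∃ c, IsTritangent G a b c)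
    (h : G.Adj l.x v) : ∃ i, v = l.c i ∨ v = l.a i := by
  by_cases hy : G.Adj l.y v
  · obtain ⟨i, hi⟩ := l.adj_c v h hy
    exact ⟨i, .inl hi⟩
  obtain ⟨w, hw⟩ := H _ _ h
  obtain ⟨i, rfl⟩ := l.adj_c w hw.adj₁₃ (hw.adj_of_not_adj l.x_ne_y.symm
    (fun e => l.not_adj_xy (e ▸ h)) (fun h => l.not_adj_xy h.symm) hy)
  exact ⟨i, .inr ((l.tri_a i).eq_of_adj h.symm hw.adj₂₃)⟩

theorem eq_of_adj_y (H : ∀ a b, G.Adj a b → ∃ c, IsTritangent G a b c)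
    (h : G.Adj l.y v) : ∃ i, v = l.c i ∨ v = l.b i := by
  by_cases hx : G.Adj l.x v
  · obtain ⟨i, hi⟩ := l.adj_c v hx h
    exact ⟨i, .inl hi⟩
  obtain ⟨w, hw⟩ := H _ _ h
  obtain ⟨i, rfl⟩ := l.adj_c w (hw.adj_of_not_adj l.x_ne_y
    (fun e => l.not_adj_xy (e ▸ h.symm)) l.not_adj_xy hx) hw.adj₁₃
  exact ⟨i, .inr ((l.tri_b i).eq_of_adj h.symm hw.adj₂₃)⟩

theorem eq_of_adj_a (H : ∀ a b, G.Adj a b → ∃ c, IsTritangent G a b c)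
    (h : G.Adj (l.a i) v) :
    v = l.x ∨ v = l.c i ∨ ∃ j, i ≠ j ∧ (v = l.b j ∨ v = l.d i j) := by
  have key : ∀ w, G.Adj (l.a i) w → G.Adj l.y w → w = l.c i ∨ ∃ j, i ≠ j ∧ w = l.b j := by
    intro w h h'
    obtain ⟨j, rfl | rfl⟩ := l.eq_of_adj_y H h'
    · by_cases hij : j = i
      · subst hij; exact .inl rfl
      · exact absurd h.symm (l.not_adj_ca hij)
    · exact .inr ⟨j, fun e => l.not_adj_ab i (e ▸ h), rfl⟩
  by_cases hy : G.Adj l.y v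
  · rcases key v h hy with h | ⟨j, hj, h⟩
    · exact .inr (.inl h)
    · exact .inr (.inr ⟨j, hj, .inl h⟩)
  obtain ⟨w, hw⟩ := H _ _ h
  have hyw := hw.adj_of_not_adj (l.a_ne_y i).symm (fun e => l.not_adj_ya i (e ▸ h.symm))
    (l.not_adj_ya i) hy
  rcases key w hw.adj₁₃ hyw with rfl | ⟨j, hj, rfl⟩
  · exact .inl ((l.tri_a i).swap₂₃.swap₁₂.swap₂₃.eq_of_adj h.symm hw.adj₂₃)
  · exact .inr (.inr ⟨j, hj, .inr ((l.tri_d i j hj).eq_of_adj h.symm hw.adj₂₃)⟩)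

theorem exists_label (H : ∀ a b, G.Adj a b → ∃ c, IsTritangent G a b c)
    (v : L) : v = l.x ∨ v = l.y ∨ (∃ i, v = l.a i) ∨ (∃ i, v = l.b i) ∨
    (∃ i, v = l.c i) ∨ (∃ i j, i ≠ j ∧ v = l.d i j) ∨ l.IsExtra v := by
  by_cases hx : v = l.x
  · exact .inl hx
  by_cases hy : v = l.y
  · exact .inr (.inl hy)
  by_cases hx' : G.Adj l.x v
  · rcases l.eq_of_adj_x H hx' with ⟨i, h | h⟩ <;> simp [h]
  by_cases hy' : G.Adj l.y v
  · rcases l.eq_of_adj_y H hy' with ⟨i, h | h⟩ <;> simp [h]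
  by_cases hc : ∃ i, v = l.c i
  · tauto
  by_cases hb : ∃ i, v = l.b i
  · tauto
  by_cases ha : ∃ i, G.Adj (l.a i) v
  · obtain ⟨i, hi⟩ := ha
    rcases l.eq_of_adj_a H hi with h | h | ⟨j, hj, h | h⟩
    · tauto
    · exact absurd ⟨i, h⟩ hc
    · exact absurd ⟨j, h⟩ hb
    · exact .inr (.inr (.inr (.inr (.inr (.inl ⟨i, j, hj, h⟩)))))
  · refine .inr (.inr (.inr (.inr (.inr (.inr ⟨hx, hy, fun h => hx' h.symm, fun h => hy' h.symm,
      fun i => ?_⟩)))))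
    exact (l.tri_a i).swap₂₃.adj_of_not_adj hx (fun e => hx' (e ▸ l.adj_xa i))
      (fun h => hx' h.symm) (fun h => ha ⟨i, h.symm⟩)

theorem adj_c_of_one (H : ∀ a b, G.Adj a b → ∃ c, IsTritangent G a b c)
    (hn : n = 1) (i : Fin n) (hv : v ≠ l.c i) : G.Adj (l.c i) v := by
  subst hn
  rcases l.exists_label H v with h | h | ⟨j, h⟩ | ⟨j, h⟩ | ⟨j, h⟩ | ⟨j, k, hjk, -⟩ | h
  · exact h ▸ (l.adj_xc i).symm
  · exact h ▸ (l.adj_yc i).symm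
  · exact Subsingleton.elim i j ▸ h ▸ l.adj_ca _
  · exact Subsingleton.elim i j ▸ h ▸ l.adj_cb _
  · exact absurd (Subsingleton.elim i j ▸ h) hv
  · exact absurd (Subsingleton.elim j k) hjk
  · exact (h.adj_c i).symm

theorem exists_tri_c_d (H : ∀ a b, G.Adj a b → ∃ c, IsTritangent G a b c)
    (hij : i ≠ j) (h : l.IsExtra v) :
    ∃ k, k ≠ i ∧ k ≠ j ∧ IsTritangent G (l.c i) (l.d j k) v := by
  obtain ⟨w, hw⟩ := H _ _ (h.adj_c i).symm
  have h1 : G.Adj (l.a j) w := hw.adj_of_not_adj (l.a_ne_c j i) (h.ne_a j).symm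
    (fun e => l.not_adj_ca hij e.symm) (fun e => h.not_adj_a j e.symm)
  rcases l.eq_of_adj_a H h1 with rfl | rfl | ⟨k, hk, rfl | rfl⟩
  · exact absurd hw.adj₂₃ h.not_adj_x
  · exact absurd hw.adj₁₃ (l.not_adj_cc _ _)
  · exact absurd hw.adj₂₃ (h.not_adj_b k)
  · refine ⟨k, ?_, hk.symm, hw.swap₂₃⟩
    rintro rfl
    exact l.not_adj_cd' hk hw.adj₁₃

end Labelling

/-- The vertices of the model graphs of order `n`. -/
inductive ModelVertex (n : ℕ) where
  | x : ModelVertex n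
  | y : ModelVertex n
  | a (i : Fin n) : ModelVertex n
  | b (i : Fin n) : ModelVertex n
  | c (i : Fin n) : ModelVertex n
  | d (i j : Fin n) (h : i < j) : ModelVertex n
  | e (h : n = 3) : ModelVertex n
deriving Fintype

namespace ModelVertex

/-- Adjacency in the model graphs. -/
def Adj {n : ℕ} : ModelVertex n → ModelVertex n → Prop
  | x, a _ | a _, x | x, c _ | c _, x | y, b _ | b _, y | y, c _ | c _, y => True
  | e _, c _ | c _, e _ | e _, d _ _ _ | d _ _ _, e _ => True
  | a i, c j | c i, a j | b i, c j | c i, b j => i = j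
  | a i, b j | b i, a j => i ≠ j
  | a i, d j k _ | d j k _, a i | b i, d j k _ | d j k _, b i => i = j ∨ i = k
  | c i, d j k _ | d j k _, c i => i ≠ j ∧ i ≠ k
  | d i j _, d k m _ => i ≠ k ∧ i ≠ m ∧ j ≠ k ∧ j ≠ m
  | _, _ => False

theorem card_three : Nat.card (ModelVertex 3) = 15 := by
  rw [Nat.card_eq_fintype_card]; rfl

theorem card_five : Nat.card (ModelVertex 5) = 27 := by
  rw [Nat.card_eq_fintype_card]; rfl

end ModelVertex

namespace Labelling

variable {L : Type*} {G : SimpleGraph L} {n : ℕ} (l : Labelling G n)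

/-- The vertex with a given label; `v` is used for the extra vertex. -/
def toVertex (v : L) : ModelVertex n → L
  | .x => l.x
  | .y => l.y
  | .a i => l.a i
  | .b i => l.b i
  | .c i => l.c i
  | .d i j _ => l.d i j
  | .e _ => v

theorem adj_toVertex {v : L} (hv : n = 3 → l.IsExtra v) (u w : ModelVertex n) :
    G.Adj (l.toVertex v u) (l.toVertex v w) ↔ u.Adj w := by
  have key : ∀ i j k m : Fin n, i < j → k < m → ¬ (i ≠ k ∧ i ≠ m ∧ j ≠ k ∧ j ≠ m) →
      ¬ G.Adj (l.d i j) (l.d k m) := by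
    intro i j k m h h' hn
    by_cases h1 : i = k
    · exact h1 ▸ l.not_adj_dd h.ne (h1 ▸ h'.ne)
    by_cases h2 : i = m
    · rw [l.d_symm h'.ne]
      exact h2 ▸ l.not_adj_dd h.ne (h2 ▸ h'.ne')
    by_cases h3 : j = k
    · rw [l.d_symm h.ne]
      exact h3 ▸ l.not_adj_dd h.ne' (h3 ▸ h'.ne)
    by_cases h4 : j = m
    · rw [l.d_symm h.ne, l.d_symm h'.ne]
      exact h4 ▸ l.not_adj_dd h.ne' (h4 ▸ h'.ne')
    · tauto
  have hca : ∀ i j, G.Adj (l.c i) (l.a j) ↔ i = j := fun i j =>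
    ⟨fun h => by_contra fun e => l.not_adj_ca e h, fun e => e ▸ l.adj_ca i⟩
  have hcb : ∀ i j, G.Adj (l.c i) (l.b j) ↔ i = j := fun i j =>
    ⟨fun h => by_contra fun e => l.not_adj_cb e h, fun e => e ▸ l.adj_cb i⟩
  have hab : ∀ i j, G.Adj (l.a i) (l.b j) ↔ i ≠ j := fun i j =>
    ⟨fun h e => l.not_adj_ab i (e ▸ h), l.adj_ab⟩
  have had : ∀ i j k, j < k → (G.Adj (l.a i) (l.d j k) ↔ i = j ∨ i = k) := fun i j k h =>
    ⟨fun h' => by_contra fun e => l.not_adj_ad h.ne (by tauto) (by tauto) h',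
      by rintro (rfl | rfl); exacts [l.adj_ad h.ne, l.adj_ad' h.ne]⟩
  have hbd : ∀ i j k, j < k → (G.Adj (l.b i) (l.d j k) ↔ i = j ∨ i = k) := fun i j k h =>
    ⟨fun h' => by_contra fun e => l.not_adj_bd h.ne (by tauto) (by tauto) h',
      by rintro (rfl | rfl); exacts [l.adj_bd' h.ne, l.adj_bd h.ne]⟩
  have hcd : ∀ i j k, j < k → (G.Adj (l.c i) (l.d j k) ↔ i ≠ j ∧ i ≠ k) := fun i j k h =>
    ⟨fun h' => ⟨fun e => l.not_adj_cd h.ne (e ▸ h'), fun e => l.not_adj_cd' h.ne (e ▸ h')⟩,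
      fun e => l.adj_cd h.ne e.1 e.2⟩
  have hdd : ∀ i j k m, i < j → k < m →
      (G.Adj (l.d i j) (l.d k m) ↔ i ≠ k ∧ i ≠ m ∧ j ≠ k ∧ j ≠ m) := fun i j k m h h' =>
    ⟨fun e => by_contra fun e' => key i j k m h h' e' e,
      fun e => l.adj_dd h.ne h'.ne e.1 e.2.1 e.2.2.1 e.2.2.2⟩
  rcases u with _ | _ | i | i | i | ⟨i, j, h⟩ | h <;>
    rcases w with _ | _ | k | k | k | ⟨k, m, h'⟩ | h' <;>
    simp only [toVertex, ModelVertex.Adj, iff_true, iff_false, SimpleGraph.irrefl]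
  all_goals first
    | apply hca | apply hcb | apply hab
    | exact had _ _ _ ‹_› | exact hbd _ _ _ ‹_› | exact hcd _ _ _ ‹_› | exact hdd _ _ _ _ h h'
    | apply l.adj_xa | apply l.adj_xc | apply l.adj_yb | apply l.adj_yc
    | apply l.not_adj_xy | apply l.not_adj_xb | apply l.not_adj_ya | exact l.not_adj_xd h'.ne
    | exact l.not_adj_yd h'.ne | apply l.not_adj_aa | apply l.not_adj_bb | apply l.not_adj_cc
    | exact (hv h).not_adj_x | exact (hv h).not_adj_y | exact (hv h).not_adj_a _
    | exact (hv h).not_adj_b _ | exact (hv h).adj_c _ | exact (hv h).adj_d h'.ne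
    | (rw [G.adj_comm]
       first
       | exact (hca _ _).trans eq_comm | exact (hcb _ _).trans eq_comm
       | exact (hab _ _).trans ne_comm
       | exact had _ _ _ ‹_› | exact hbd _ _ _ ‹_› | exact hcd _ _ _ ‹_›
       | apply l.adj_xa | apply l.adj_xc | apply l.adj_yb | apply l.adj_yc
       | apply l.not_adj_xy | apply l.not_adj_xb | apply l.not_adj_ya | exact l.not_adj_xd h.ne
       | exact l.not_adj_yd h.ne
       | exact (hv h').not_adj_x | exact (hv h').not_adj_y | exact (hv h').not_adj_a _
       | exact (hv h').not_adj_b _ | exact (hv h').adj_c _ | exact (hv h').adj_d h.ne)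

theorem toVertex_injective {v : L} (hv : n = 3 → l.IsExtra v) :
    Function.Injective (l.toVertex v) := by
  intro u w huw
  have hadj : ∀ z, u.Adj z ↔ w.Adj z := fun z => by
    rw [← l.adj_toVertex hv, ← l.adj_toVertex hv, huw]
  have hd : ∀ i j k m, i < j → k < m → l.d i j = l.d k m → i = k ∧ j = m := by
    intro i j k m h h' e
    have h1 : i = k ∨ i = m := by
      by_contra! hn; exact l.d_ne_d h.ne h'.ne hn.1 hn.2 e
    have h2 : j = k ∨ j = m := by
      rw [l.d_symm h.ne] at e
      by_contra! hn; exact l.d_ne_d h.ne' h'.ne hn.1 hn.2 e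
    omega
  rcases u with _ | _ | i | i | i | ⟨i, j, h⟩ | h <;>
    rcases w with _ | _ | k | k | k | ⟨k, m, h'⟩ | h' <;>
    simp only [toVertex] at huw
  all_goals first
    | rfl
    | exact congrArg _ (l.a_injective huw)
    | exact congrArg _ (l.b_injective huw)
    | exact congrArg _ (l.c_injective huw)
    | (obtain ⟨rfl, rfl⟩ := hd _ _ _ _ h h' huw; rfl)
    | exact absurd huw l.x_ne_y | exact absurd huw l.x_ne_y.symm
    | exact absurd huw (l.a_ne_y _) | exact absurd huw (l.a_ne_y _).symm
    | exact absurd huw (l.b_ne_x _) | exact absurd huw (l.b_ne_x _).symm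
    | exact absurd huw (l.a_ne_b _ _) | exact absurd huw (l.a_ne_b _ _).symm
    | exact absurd huw (l.a_ne_c _ _) | exact absurd huw (l.a_ne_c _ _).symm
    | exact absurd huw (l.b_ne_c _ _) | exact absurd huw (l.b_ne_c _ _).symm
    | exact absurd huw (l.adj_xa _).ne | exact absurd huw (l.adj_xa _).ne'
    | exact absurd huw (l.adj_xc _).ne | exact absurd huw (l.adj_xc _).ne'
    | exact absurd huw (l.adj_yb _).ne | exact absurd huw (l.adj_yb _).ne'
    | exact absurd huw (l.adj_yc _).ne | exact absurd huw (l.adj_yc _).ne'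
    | exact absurd huw (hv h).ne_x | exact absurd huw.symm (hv h').ne_x
    | exact absurd huw (hv h).ne_y | exact absurd huw.symm (hv h').ne_y
    | exact absurd huw ((hv h).ne_a _) | exact absurd huw.symm ((hv h').ne_a _)
    | exact absurd huw ((hv h).ne_b _) | exact absurd huw.symm ((hv h').ne_b _)
    | exact absurd huw ((hv h).ne_c _) | exact absurd huw.symm ((hv h').ne_c _)
    | exact absurd huw ((hv h).adj_d h'.ne).ne | exact absurd huw.symm ((hv h').adj_d h.ne).ne
    | exact absurd huw (l.a_ne_d h'.ne _) | exact absurd huw.symm (l.a_ne_d h.ne _)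
    | exact absurd huw (l.b_ne_d h'.ne _) | exact absurd huw.symm (l.b_ne_d h.ne _)
    | exact absurd huw (l.c_ne_d h'.ne _) | exact absurd huw.symm (l.c_ne_d h.ne _)
    | (have := hadj (.a i); simp [ModelVertex.Adj] at this; done)
    | (have := hadj (.a k); simp [ModelVertex.Adj] at this; done)
    | (have := hadj (.c i); simp [ModelVertex.Adj] at this)
    | (have := hadj (.c k); simp [ModelVertex.Adj] at this)

theorem toVertex_surjective {v : L} (H : ∀ a b, G.Adj a b → ∃ c, IsTritangent G a b c)
    (he : ∀ w, l.IsExtra w → n = 3 ∧ w = v) : Function.Surjective (l.toVertex v) := by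
  intro w
  rcases l.exists_label H w with h | h | ⟨i, h⟩ | ⟨i, h⟩ | ⟨i, h⟩ | ⟨i, j, hij, h⟩ | h
  · exact ⟨.x, h.symm⟩
  · exact ⟨.y, h.symm⟩
  · exact ⟨.a i, h.symm⟩
  · exact ⟨.b i, h.symm⟩
  · exact ⟨.c i, h.symm⟩
  · rcases lt_or_gt_of_ne hij with h' | h'
    · exact ⟨.d i j h', h.symm⟩
    · exact ⟨.d j i h', by rw [h, l.d_symm hij]; rfl⟩
  · exact ⟨.e (he w h).1, (he w h).2.symm⟩

theorem exists_equiv_of_extra (l : Labelling G n) (v : L)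
    (H : ∀ a b, G.Adj a b → ∃ c, IsTritangent G a b c)
    (hv : n = 3 → l.IsExtra v) (he : ∀ w, l.IsExtra w → n = 3 ∧ w = v) :
    ∃ φ : ModelVertex n ≃ L, ∀ u w, G.Adj (φ u) (φ w) ↔ u.Adj w :=
  ⟨Equiv.ofBijective _ ⟨l.toVertex_injective hv, l.toVertex_surjective H he⟩, l.adj_toVertex hv⟩

theorem exists_equiv (l : Labelling G n) (H : ∀ a b, G.Adj a b → ∃ c, IsTritangent G a b c)
    (hn : n = 3 ∨ n = 5) :
    ∃ φ : ModelVertex n ≃ L, ∀ u w, G.Adj (φ u) (φ w) ↔ u.Adj w := by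
  rcases hn with rfl | rfl
  · have h12 : (1 : Fin 3) ≠ 2 := by decide
    obtain ⟨v, hv⟩ := H _ _ (l.adj_cd (k := 0) h12 (by decide) (by decide))
    refine l.exists_equiv_of_extra v H (fun _ => ?_) fun w hw => ⟨rfl, ?_⟩
    · rcases l.exists_label H v with h | h | ⟨i, h⟩ | ⟨i, h⟩ | ⟨i, h⟩ | ⟨i, j, hij, h⟩ | h
      · exact absurd (h ▸ hv.adj₂₃.symm) (l.not_adj_xd h12)
      · exact absurd (h ▸ hv.adj₂₃.symm) (l.not_adj_yd h12)
      · have h0 : 0 = i := by_contra fun e => l.not_adj_ca e (h ▸ hv.adj₁₃)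
        exact absurd (h ▸ hv.adj₂₃.symm) (l.not_adj_ad h12 (h0 ▸ by decide) (h0 ▸ by decide))
      · have h0 : 0 = i := by_contra fun e => l.not_adj_cb e (h ▸ hv.adj₁₃)
        exact absurd (h ▸ hv.adj₂₃.symm) (l.not_adj_bd h12 (h0 ▸ by decide) (h0 ▸ by decide))
      · exact absurd (h ▸ hv.adj₁₃) (l.not_adj_cc _ _)
      · have hc : G.Adj (l.c 0) (l.d i j) := h ▸ hv.adj₁₃
        have hi : i ≠ 0 := by rintro rfl; exact l.not_adj_cd hij hc
        have hj : j ≠ 0 := by rintro rfl; exact l.not_adj_cd' hij hc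
        have h' : l.d i j = l.d 1 2 := by
          have : i = 1 ∧ j = 2 ∨ i = 2 ∧ j = 1 := by omega
          rcases this with ⟨rfl, rfl⟩ | ⟨rfl, rfl⟩
          exacts [rfl, l.d_symm hij]
        exact absurd (h.trans h') hv.adj₂₃.ne'
      · exact h
    · obtain ⟨k, hk0, hk1, hk⟩ := l.exists_tri_c_d H (i := 0) (j := 1) (by decide) hw
      obtain rfl : k = 2 := by omega
      exact hv.eq_of_adj hk.adj₁₃.symm hk.adj₂₃.symm
  · refine l.exists_equiv_of_extra l.x H (fun h => absurd h (by decide)) fun w hw => ?_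
    obtain ⟨k, hk0, hk1, hk⟩ := l.exists_tri_c_d H (i := 0) (j := 1) (by decide) hw
    obtain ⟨p, q, hpq, hp, hq⟩ : ∃ p q : Fin 5, p ≠ q ∧ (p ≠ 0 ∧ p ≠ 1 ∧ p ≠ k) ∧
        q ≠ 0 ∧ q ≠ 1 ∧ q ≠ k := by
      clear hk hk0 hk1
      revert k
      decide
    have h1 := hk.eq_of_adj (l.adj_cd hpq hp.1.symm hq.1.symm).symm
      (l.adj_dd hpq hk1.symm hp.2.1 hp.2.2 hq.2.1 hq.2.2)
    exact absurd (h1 ▸ (hw.adj_c p).symm) (l.not_adj_cd hpq)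

end Labelling

/-- Two fixed-point-free involutions on finite types of the same size are conjugate. -/
theorem exists_equiv_of_involutive {α β : Type*} [Finite α] [Finite β] (f : α → α) (g : β → β)
    (hf : f.Involutive) (hg : g.Involutive) (hf' : ∀ a, f a ≠ a) (hg' : ∀ b, g b ≠ b)
    (hcard : Nat.card α = Nat.card β) : ∃ e : α ≃ β, ∀ a, e (f a) = g (e a) := by
  classical
  have := Fintype.ofFinite α
  have := Fintype.ofFinite β
  let e₀ : α ≃ β := (Finite.card_eq.1 hcard).some
  let p : Equiv.Perm β := e₀.permCongr hf.toPerm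
  let q : Equiv.Perm β := hg.toPerm
  have hp : ∀ b, p b ≠ b := fun b h => hf' (e₀.symm b) (by
    have : e₀ (f (e₀.symm b)) = b := h
    rw [← e₀.symm_apply_apply (f _), this])
  have key : ∀ r : Equiv.Perm β, r ^ 2 = 1 → (∀ b, r b ≠ b) →
      r.cycleType = Multiset.replicate (Fintype.card β / 2) 2 := by
    intro r hr hr'
    have h1 := Equiv.Perm.cycleType_of_pow_prime_eq_one hr
    have h2 := r.sum_cycleType
    have h3 : r.support = Finset.univ := by ext; simp [hr']
    rw [h1, h3, Finset.card_univ, Multiset.sum_replicate, smul_eq_mul] at h2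
    rw [h1, ← h2]
    simp
  have hp2 : p ^ 2 = 1 := by
    ext b
    simp [pow_two, p, hf (e₀.symm b)]
  have hq2 : q ^ 2 = 1 := by
    ext b
    simp [pow_two, q, hg b]
  obtain ⟨c, hc⟩ := isConj_iff.1 (Equiv.Perm.isConj_iff_cycleType_eq.2
    ((key p hp2 hp).trans (key q hq2 hg').symm))
  refine ⟨e₀.trans c, fun a => ?_⟩
  have := congrArg (fun r : Equiv.Perm β => r (c (e₀ a))) hc
  simpa [p, q] using this

theorem exists_involutive_of_universal {L : Type*} {G : SimpleGraph L}
    (H : ∀ a b, G.Adj a b → ∃ c, IsTritangent G a b c) {u : L} (hu : ∀ v, v ≠ u → G.Adj u v) :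
    ∃ f : {v // v ≠ u} → {v // v ≠ u}, f.Involutive ∧ (∀ a, f a ≠ a) ∧
      ∀ a b : {v // v ≠ u}, G.Adj a b ↔ b = f a := by
  choose! f hf using fun v (hv : v ≠ u) => H u v (hu v hv)
  refine ⟨fun v => ⟨f v, (hf v v.2).adj₁₃.ne'⟩, fun v => ?_, fun v h => ?_, fun v v' => ?_⟩
  · have h := hf v v.2
    exact Subtype.ext ((hf _ h.adj₁₃.ne').eq_of_adj (hu v v.2).symm h.adj₂₃).symm
  · exact (hf v v.2).adj₂₃.ne' (congrArg Subtype.val h)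
  · refine ⟨fun h => Subtype.ext ((hf v v.2).eq_of_adj (hu _ v'.2).symm h.symm), ?_⟩
    rintro rfl
    exact (hf v v.2).adj₂₃

/-- A graph in which the third-vertex axiom holds and some vertex meets all others
is determined by its number of vertices. -/
theorem exists_equiv_of_universal {L L' : Type*} [Finite L] [Finite L'] {G : SimpleGraph L}
    {G' : SimpleGraph L'} (H : ∀ a b, G.Adj a b → ∃ c, IsTritangent G a b c)
    (H' : ∀ a b, G'.Adj a b → ∃ c, IsTritangent G' a b c) {u : L} {u' : L'}
    (hu : ∀ v, v ≠ u → G.Adj u v) (hu' : ∀ v, v ≠ u' → G'.Adj u' v)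
    (hcard : Nat.card L = Nat.card L') :
    ∃ σ : L ≃ L', ∀ a b, G.Adj a b ↔ G'.Adj (σ a) (σ b) := by
  classical
  obtain ⟨f, hf, hf1, hf2⟩ := exists_involutive_of_universal H hu
  obtain ⟨g, hg, hg1, hg2⟩ := exists_involutive_of_universal H' hu'
  have hc : Nat.card {v // v ≠ u} = Nat.card {v // v ≠ u'} := by
    have := Fintype.ofFinite L
    have := Fintype.ofFinite L'
    simp only [Nat.card_eq_fintype_card] at hcard ⊢
    simp [Fintype.card_subtype_compl, hcard]
  obtain ⟨e, he⟩ := exists_equiv_of_involutive f g hf hg hf1 hg1 hc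
  let σ : L ≃ L' := (Equiv.optionSubtypeNe u).symm.trans
    (e.optionCongr.trans (Equiv.optionSubtypeNe u'))
  have h0 : σ u = u' := by simp [σ]
  have h1 : ∀ v : {v // v ≠ u}, σ v = e v := fun v => by
    simp [σ, Equiv.optionSubtypeNe_symm_of_ne v.2]
  refine ⟨σ, fun a b => ?_⟩
  by_cases ha : a = u
  · subst ha
    by_cases hb : b = a
    · subst hb; simp
    · rw [h0]
      exact iff_of_true (hu b hb) (hu' _ fun h => hb (σ.injective (h.trans h0.symm)))
  by_cases hb : b = u
  · subst hb
    rw [h0]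
    exact iff_of_true (hu a ha).symm (hu' _ fun h => ha (σ.injective (h.trans h0.symm))).symm
  rw [h1 ⟨a, ha⟩, h1 ⟨b, hb⟩, hg2, ← he, e.injective.eq_iff]
  exact hf2 ⟨a, ha⟩ ⟨b, hb⟩

theorem Labelling.ncard_neighborSet {L : Type*} {G : SimpleGraph L} {n : ℕ} (l : Labelling G n)
    (H : ∀ a b, G.Adj a b → ∃ c, IsTritangent G a b c) : (G.neighborSet l.x).ncard = 2 * n := by
  have : G.neighborSet l.x = Set.range (Sum.elim l.c l.a) := by
    ext v
    simp only [SimpleGraph.mem_neighborSet, Set.mem_range, Sum.exists, Sum.elim_inl, Sum.elim_inr]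
    constructor
    · intro h
      obtain ⟨i, rfl | rfl⟩ := l.eq_of_adj_x H h
      exacts [.inl ⟨i, rfl⟩, .inr ⟨i, rfl⟩]
    · rintro (⟨i, rfl⟩ | ⟨i, rfl⟩)
      exacts [l.adj_xc i, l.adj_xa i]
  rw [this, ← Nat.card_coe_set_eq, Nat.card_range_of_injective
    (l.c_injective.sumElim l.a_injective fun i j => (l.a_ne_c j i).symm)]
  simp [two_mul]

theorem exists_labelling {L : Type*} [Finite L] {G : SimpleGraph L}
    (H : ∀ a b, G.Adj a b → ∃ c, IsTritangent G a b c) {x y : L} (hne : x ≠ y)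
    (hxy : ¬G.Adj x y) : ∃ n, ∃ l : Labelling G n, l.x = x := by
  let S := {v // G.Adj x v ∧ G.Adj y v}
  let c := (Finite.equivFin S).symm
  choose a ha using fun i => H x (c i) (c i).2.1
  choose b hb using fun i => H y (c i) (c i).2.2
  have hab : ∀ i j, i ≠ j → G.Adj (a i) (b j) := by
    intro i j hij
    have h1 : ¬G.Adj y (a i) := (ha i).swap₁₂.swap₂₃.not_adj (c i).2.2 hne.symm
    have h2 : ¬G.Adj (c j : L) (a i) := (ha i).swap₂₃.not_adj (c j).2.1.symm
      fun h => hij (c.injective (Subtype.ext h)).symm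
    exact (hb j).adj_of_not_adj (fun h => hxy (h ▸ (ha i).adj₁₃))
      (fun h => h1 (h ▸ (c j).2.2)) (fun h => h1 h.symm) fun h => h2 h.symm
  have : Nonempty L := ⟨x⟩
  choose! d hd using fun i j h => H _ _ (hab i j h)
  exact ⟨_, ⟨x, y, a, b, fun i => c i, d, hne, hxy, Subtype.val_injective.comp c.injective,
    fun v h h' => ⟨c.symm ⟨v, h, h'⟩, by simp⟩, ha, hb, hd⟩, rfl⟩

/-- The incidence properties of the real lines on a smooth cubic surface which determine the
intersection graph from the number of lines. -/
structure IsCubicLineGraph {L : Type*} (G : SimpleGraph L) : Prop where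
  third : ∀ a b, G.Adj a b → ∃ c, IsTritangent G a b c
  degree_le : ∀ a, (G.neighborSet a).ncard ≤ 10
  universal_or_degree : ∀ a,
    (∀ v, v ≠ a → G.Adj a v) ∨ (G.neighborSet a).ncard ∈ ({2, 6, 10} : Set ℕ)

theorem IsCubicLineGraph.classify {L : Type*} [Finite L] [Nonempty L] {G : SimpleGraph L}
    (h : IsCubicLineGraph G) :
    (Nat.card L ≤ 11 ∧ ∃ u, ∀ v, v ≠ u → G.Adj u v) ∨
      (Nat.card L = 15 ∧ ∃ φ : ModelVertex 3 ≃ L, ∀ u w, G.Adj (φ u) (φ w) ↔ u.Adj w) ∨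
      (Nat.card L = 27 ∧ ∃ φ : ModelVertex 5 ≃ L, ∀ u w, G.Adj (φ u) (φ w) ↔ u.Adj w) := by
  by_cases hU : ∃ u, ∀ v, v ≠ u → G.Adj u v
  · refine .inl ⟨?_, hU⟩
    obtain ⟨u, hu⟩ := hU
    have h1 : (Set.univ : Set L) ⊆ insert u (G.neighborSet u) := fun v _ => by
      by_cases hv : v = u
      · exact .inl hv
      · exact .inr (hu v hv)
    have h2 := Set.ncard_le_ncard h1
    have h3 := Set.ncard_insert_le u (G.neighborSet u)
    have h4 := h.degree_le u
    rw [Set.ncard_univ] at h2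
    omega
  · refine .inr ?_
    push Not at hU
    obtain ⟨x⟩ := ‹Nonempty L›
    obtain ⟨y, hne, hxy⟩ := hU x
    obtain ⟨n, l, rfl⟩ := exists_labelling h.third hne.symm hxy
    have hdeg := (h.universal_or_degree l.x).resolve_left fun hu => hxy (hu y hne)
    rw [l.ncard_neighborSet h.third] at hdeg
    have hn : n = 1 ∨ n = 3 ∨ n = 5 := by
      simp only [Set.mem_insert_iff, Set.mem_singleton_iff] at hdeg
      omega
    rcases hn with rfl | rfl | rfl
    · obtain ⟨v, hv, hv'⟩ := hU (l.c 0)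
      exact absurd (l.adj_c_of_one h.third rfl 0 hv) hv'
    · obtain ⟨φ, hφ⟩ := l.exists_equiv h.third (.inl rfl)
      exact .inl ⟨(Nat.card_congr φ).symm.trans ModelVertex.card_three, φ, hφ⟩
    · obtain ⟨φ, hφ⟩ := l.exists_equiv h.third (.inr rfl)
      exact .inr ⟨(Nat.card_congr φ).symm.trans ModelVertex.card_five, φ, hφ⟩

theorem IsCubicLineGraph.exists_equiv {L L' : Type*} [Finite L] [Finite L'] {G : SimpleGraph L}
    {G' : SimpleGraph L'} (h : IsCubicLineGraph G) (h' : IsCubicLineGraph G')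
    (hcard : Nat.card L = Nat.card L') :
    ∃ σ : L ≃ L', ∀ a b, G.Adj a b ↔ G'.Adj (σ a) (σ b) := by
  rcases isEmpty_or_nonempty L with hL | hL
  · exact ⟨(Finite.card_eq.1 hcard).some, fun a => hL.elim a⟩
  have : Nonempty L' := ((Finite.card_eq.1 hcard).some).nonempty_congr.1 hL
  rcases h.classify with ⟨h1, u, hu⟩ | ⟨h1, φ, hφ⟩ | ⟨h1, φ, hφ⟩ <;>
    rcases h'.classify with ⟨h2, u', hu'⟩ | ⟨h2, φ', hφ'⟩ | ⟨h2, φ', hφ'⟩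
  any_goals omega
  · exact exists_equiv_of_universal h.third h'.third hu hu' hcard
  all_goals
    refine ⟨φ.symm.trans φ', fun a b => ?_⟩
    rw [Equiv.trans_apply, Equiv.trans_apply, hφ', ← hφ, φ.apply_symm_apply, φ.apply_symm_apply]

end LineGraph

/-- A symmetric trilinear form on a four-dimensional real space whose associated cubic has no
complex singular point `u + i v`. -/
structure IsSmoothTrilinear {V : Type*} [AddCommGroup V] [Module ℝ V]
    (T : V →ₗ[ℝ] V →ₗ[ℝ] V →ₗ[ℝ] ℝ) : Prop where
  finrank_eq : Module.finrank ℝ V = 4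
  swap₁₂ : ∀ u v w, T u v w = T v u w
  swap₂₃ : ∀ u v w, T u v w = T u w v
  smooth : ∀ u v, (∀ w, T u u w = T v v w) → (∀ w, T u v w = 0) → u = 0 ∧ v = 0

/-- A two-dimensional subspace on which the cubic form of `T` vanishes. -/
structure IsNullLine {V : Type*} [AddCommGroup V] [Module ℝ V]
    (T : V →ₗ[ℝ] V →ₗ[ℝ] V →ₗ[ℝ] ℝ) (W : Submodule ℝ V) : Prop where
  finrank_eq : Module.finrank ℝ W = 2
  null : ∀ w ∈ W, T w w w = 0

section LinearAlgebra

open Module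

variable {V : Type*} [AddCommGroup V] [Module ℝ V]

theorem finrank_span_pair_eq_two {x y : V}
    (h : ∀ α β : ℝ, α • x + β • y = 0 → α = 0 ∧ β = 0) :
    finrank ℝ (Submodule.span ℝ {x, y}) = 2 := by
  have := finrank_span_eq_card (LinearIndependent.pair_iff.2 h)
  rw [show Set.range ![x, y] = {x, y} by ext; simp [eq_comm, or_comm]] at this
  simpa using this

theorem exists_pair_of_mem {W : Submodule ℝ V} (hW : finrank ℝ W = 2) {p : V} (hp : p ∈ W)
    (hp0 : p ≠ 0) : ∃ u ∈ W, (∀ α β : ℝ, α • p + β • u = 0 → α = 0 ∧ β = 0) ∧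
      Submodule.span ℝ {p, u} = W := by
  have : FiniteDimensional ℝ W := FiniteDimensional.of_finrank_pos (by omega)
  obtain ⟨u, hu, hup⟩ : ∃ u ∈ W, u ∉ Submodule.span ℝ {p} := by
    by_contra! hn
    have h1 := Submodule.finrank_mono (show W ≤ Submodule.span ℝ {p} from hn)
    rw [hW, finrank_span_singleton hp0] at h1
    omega
  have h : ∀ α β : ℝ, α • p + β • u = 0 → α = 0 ∧ β = 0 :=
    LinearIndependent.pair_iff.1 ((LinearIndependent.pair_iff' hp0).2 fun a ha =>
      hup (Submodule.mem_span_singleton.2 ⟨a, ha⟩))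
  refine ⟨u, hu, h, Submodule.eq_of_le_of_finrank_eq ?_ ?_⟩
  · rw [Submodule.span_le]; rintro x (rfl | rfl) <;> assumption
  · rw [finrank_span_pair_eq_two h, hW]

theorem le_of_subset_union {U W₁ W₂ W₃ : Submodule ℝ V}
    (h : ∀ x ∈ U, x ∈ W₁ ∨ x ∈ W₂ ∨ x ∈ W₃) : U ≤ W₁ ∨ U ≤ W₂ ∨ U ≤ W₃ := by
  classical
  by_contra! hn
  let s : Finset (Submodule ℝ U) :=
    {W₁.comap U.subtype, W₂.comap U.subtype, W₃.comap U.subtype}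
  refine Subspace.biUnion_ne_univ_of_top_notMem (s := s) (E := U) ?_ ?_
  · simp only [s, Finset.mem_insert, Finset.mem_singleton, not_or, eq_comm (a := ⊤),
      Submodule.comap_subtype_eq_top]
    exact hn
  · ext x
    simpa [s] using h x x.2

variable [FiniteDimensional ℝ V]

theorem exists_mem_inf_ne_zero {U W P : Submodule ℝ V} (hU : U ≤ P) (hW : W ≤ P)
    (h : finrank ℝ P < finrank ℝ U + finrank ℝ W) : ∃ x, x ∈ U ∧ x ∈ W ∧ x ≠ 0 := by
  have h1 := Submodule.finrank_sup_add_finrank_inf_eq U W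
  have h2 := Submodule.finrank_mono (sup_le hU hW)
  have h3 : U ⊓ W ≠ ⊥ := fun h => by rw [h, finrank_bot] at h1; omega
  obtain ⟨x, hx, hx0⟩ := Submodule.exists_mem_ne_zero_of_ne_bot h3
  exact ⟨x, hx.1, hx.2, hx0⟩

theorem eq_of_le_of_finrank_two {U W : Submodule ℝ V} (h : U ≤ W) (hU : finrank ℝ U = 2)
    (hW : finrank ℝ W = 2) : U = W :=
  Submodule.eq_of_le_of_finrank_eq h (hU.trans hW.symm)

theorem finrank_sup_eq_three {U W : Submodule ℝ V} (hU : finrank ℝ U = 2) (hW : finrank ℝ W = 2)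
    (hne : U ≠ W) {x : V} (hx : x ∈ U) (hx' : x ∈ W) (hx0 : x ≠ 0) :
    finrank ℝ (U ⊔ W : Submodule ℝ V) = 3 := by
  have h1 := Submodule.finrank_sup_add_finrank_inf_eq U W
  have h2 : finrank ℝ (U ⊓ W : Submodule ℝ V) < 2 := by
    rw [← hU]
    refine Submodule.finrank_lt_finrank_of_lt (lt_of_le_of_ne inf_le_left fun h => hne ?_)
    exact eq_of_le_of_finrank_two (inf_eq_left.1 h) hU hW
  have h3 : 1 ≤ finrank ℝ (U ⊓ W : Submodule ℝ V) :=
    Submodule.one_le_finrank_iff.2 fun h => hx0 ((Submodule.mem_bot ℝ).1 (h ▸ ⟨hx, hx'⟩))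
  omega

theorem exists_smul_eq_of_finrank_lt {U P : Submodule ℝ V} (hU : finrank ℝ U = 2)
    (hUP : ¬U ≤ P) {x y : V} (hxU : x ∈ U) (hxP : x ∈ P) (hx0 : x ≠ 0) (hyU : y ∈ U)
    (hyP : y ∈ P) : ∃ c : ℝ, c • x = y := by
  by_contra! hn
  have h := LinearIndependent.pair_iff.1 ((LinearIndependent.pair_iff' hx0).2 hn)
  have h1 := finrank_span_pair_eq_two h
  have h2 : Submodule.span ℝ {x, y} ≤ U := by
    rw [Submodule.span_le]; rintro z (rfl | rfl) <;> assumption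
  refine hUP (eq_of_le_of_finrank_two h2 h1 hU ▸ ?_)
  rw [Submodule.span_le]; rintro z (rfl | rfl) <;> assumption

theorem sup_eq_top_of_not_le {U P : Submodule ℝ V} (hV : finrank ℝ V = 4) (hP : finrank ℝ P = 3)
    (hUP : ¬U ≤ P) : U ⊔ P = ⊤ := by
  refine Submodule.eq_top_of_finrank_eq ?_
  have h1 := Submodule.finrank_lt_finrank_of_lt (right_lt_sup.2 hUP)
  have h2 := Submodule.finrank_le (U ⊔ P)
  omega

end LinearAlgebra

section NullLine

open Module

theorem exists_sub_smul_mem {V : Type*} [AddCommGroup V] [Module ℝ V] [FiniteDimensional ℝ V]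
    {P : Submodule ℝ V} (hV : finrank ℝ V = 4) (hP : finrank ℝ P = 3) :
    ∃ n : V, ∀ v, ∃ c : ℝ, v - c • n ∈ P := by
  obtain ⟨n, hn⟩ : ∃ n, n ∉ P := by
    by_contra! hn
    rw [Submodule.eq_top_iff'.2 hn, finrank_top] at hP
    omega
  have htop : Submodule.span ℝ {n} ⊔ P = ⊤ := by
    refine Submodule.eq_top_of_finrank_eq ?_
    have h1 := Submodule.finrank_lt_finrank_of_lt
      (right_lt_sup.2 fun h : Submodule.span ℝ {n} ≤ P =>
        hn (h (Submodule.mem_span_singleton_self n)))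
    have h2 := Submodule.finrank_le (Submodule.span ℝ {n} ⊔ P)
    omega
  refine ⟨n, fun v => ?_⟩
  obtain ⟨y, hy, z, hz, rfl⟩ := Submodule.mem_sup.1 (htop ▸ Submodule.mem_top : v ∈ _)
  obtain ⟨c, rfl⟩ := Submodule.mem_span_singleton.1 hy
  exact ⟨c, by simpa using hz⟩

/-- Explicit bases of the plane `2 a A + b B + c C = 0`. -/
theorem exists_basis_plane {A B C : ℝ} (hAB : ¬(A = 0 ∧ B = 0)) (hAC : ¬(A = 0 ∧ C = 0)) :
    ∃ a₁ b₁ c₁ a₂ b₂ c₂ : ℝ, 2 * a₁ * A + b₁ * B + c₁ * C = 0 ∧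
      2 * a₂ * A + b₂ * B + c₂ * C = 0 ∧
      (∀ s t : ℝ, s * a₁ + t * a₂ = 0 → s * b₁ + t * b₂ = 0 → s * c₁ + t * c₂ = 0 →
        s = 0 ∧ t = 0) ∧
      (∀ a b c : ℝ, 2 * a * A + b * B + c * C = 0 →
        ∃ s t : ℝ, s * a₁ + t * a₂ = a ∧ s * b₁ + t * b₂ = b ∧ s * c₁ + t * c₂ = c) ∧
      (b₁ ≠ 0 ∨ b₂ ≠ 0) ∧ (c₁ ≠ 0 ∨ c₂ ≠ 0) := by
  by_cases hA : A = 0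
  · have hB : B ≠ 0 := fun h => hAB ⟨hA, h⟩
    have hC : C ≠ 0 := fun h => hAC ⟨hA, h⟩
    refine ⟨1, 0, 0, 0, C, -B, by simp [hA], by ring, fun s t h1 h2 h3 => ⟨by simpa using h1, ?_⟩,
      fun a b c h => ⟨a, b / C, by ring, by field_simp; ring, ?_⟩, Or.inr hC,
      Or.inr (neg_ne_zero.2 hB)⟩
    · simpa [hC] using h2
    · field_simp
      rw [hA] at h
      linear_combination -h
  · refine ⟨-B, 2 * A, 0, -C, 0, 2 * A, by ring, by ring, fun s t h1 h2 h3 => ⟨?_, ?_⟩,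
      fun a b c h => ⟨b / (2 * A), c / (2 * A), ?_, by field_simp; ring, by field_simp; ring⟩,
      Or.inl (by simpa), Or.inr (by simpa)⟩
    · simpa [hA] using h2
    · simpa [hA] using h3
    · field_simp
      linear_combination -h

variable {V : Type*} [AddCommGroup V] [Module ℝ V] {T : V →ₗ[ℝ] V →ₗ[ℝ] V →ₗ[ℝ] ℝ}

namespace IsSmoothTrilinear

theorem finiteDimensional (h : IsSmoothTrilinear T) : FiniteDimensional ℝ V :=
  FiniteDimensional.of_finrank_pos (by rw [h.finrank_eq]; norm_num)

theorem eq_zero_of_forall (h : IsSmoothTrilinear T) {z : V} (hz : ∀ x, T z z x = 0) : z = 0 :=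
  (h.smooth z 0 (by simpa using hz) (by simp)).1

theorem not_double (h : IsSmoothTrilinear T) {z z' n : V}
    (hz : ∀ α β : ℝ, α • z + β • z' = 0 → α = 0 ∧ β = 0) {P : Submodule ℝ V}
    (hn : ∀ v, ∃ c : ℝ, v - c • n ∈ P) (h₁ : ∀ x ∈ P, T z z x = 0)
    (h₂ : ∀ x ∈ P, T z z' x = 0) (h₃ : ∀ x ∈ P, T z' z' x = 0) : False := by
  have key : ∀ v, ∃ c : ℝ, T z z v = c * T z z n ∧ T z z' v = c * T z z' n ∧
      T z' z' v = c * T z' z' n := fun v => by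
    obtain ⟨c, hc⟩ := hn v
    have e₁ := h₁ _ hc
    have e₂ := h₂ _ hc
    have e₃ := h₃ _ hc
    simp only [map_sub, map_smul, smul_eq_mul] at e₁ e₂ e₃
    exact ⟨c, by linarith, by linarith, by linarith⟩
  set A := T z z n
  set B := T z z' n
  set C := T z' z' n
  have hA : A ≠ 0 := fun hA => by
    have := h.eq_zero_of_forall (z := z) fun x => by
      obtain ⟨c, hc, -⟩ := key x
      rw [hc, hA, mul_zero]
    simpa using (hz 1 0 (by simp [this])).1
  rcases le_or_gt 0 (B ^ 2 - A * C) with hD | hD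
  · have hs := Real.sq_sqrt hD
    set s := √(B ^ 2 - A * C)
    refine hA (hz (-B + s) A (h.eq_zero_of_forall fun x => ?_)).2
    obtain ⟨c, e₁, e₂, e₃⟩ := key x
    simp only [map_add, map_smul, LinearMap.add_apply, LinearMap.smul_apply, smul_eq_mul,
      h.swap₁₂ z' z, e₁, e₂, e₃]
    linear_combination A * c * hs
  · have hs := Real.sq_sqrt (neg_pos.2 hD).le
    set s := √(-(B ^ 2 - A * C))
    refine hA (hz (-B) A (h.smooth ((-B) • z + A • z') (s • z) (fun x => ?_) fun x => ?_).1).2 <;>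
    obtain ⟨c, e₁, e₂, e₃⟩ := key x <;>
    simp only [map_add, map_smul, LinearMap.add_apply, LinearMap.smul_apply, smul_eq_mul,
      h.swap₁₂ z' z, e₁, e₂, e₃]
    · linear_combination -A * c * hs
    · ring

end IsSmoothTrilinear

namespace IsNullLine

variable {W W₁ W₂ W₃ : Submodule ℝ V}

theorem polar (h : IsSmoothTrilinear T) (hW : IsNullLine T W) {u v w : V} (hu : u ∈ W)
    (hv : v ∈ W) (hw : w ∈ W) : T u v w = 0 := by
  have key : ∀ x ∈ W, ∀ y ∈ W, T x x y = 0 := fun x hx y hy => by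
    have h1 := hW.null _ (add_mem hx hy)
    have h2 := hW.null _ (sub_mem hx hy)
    have h3 := hW.null _ hx
    have h4 := hW.null _ hy
    simp only [map_add, map_sub, LinearMap.add_apply, LinearMap.sub_apply, h.swap₁₂ y x,
      h.swap₂₃ x y x, h3, h4] at h1 h2
    linarith
  have h1 := key _ (add_mem hu hv) _ hw
  simp only [map_add, LinearMap.add_apply, h.swap₁₂ v u, key _ hu _ hw, key _ hv _ hw] at h1
  linarith

theorem span_pair (h : IsSmoothTrilinear T) {x y : V}
    (hxy : ∀ α β : ℝ, α • x + β • y = 0 → α = 0 ∧ β = 0) (h₁ : T x x x = 0) (h₂ : T x x y = 0)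
    (h₃ : T x y y = 0) (h₄ : T y y y = 0) : IsNullLine T (Submodule.span ℝ {x, y}) where
  finrank_eq := finrank_span_pair_eq_two hxy
  null w hw := by
    obtain ⟨a, b, rfl⟩ := Submodule.mem_span_pair.1 hw
    simp only [map_add, map_smul, LinearMap.add_apply, LinearMap.smul_apply, smul_eq_mul,
      h.swap₁₂ y x, h.swap₂₃ x y x, h.swap₂₃ y y x, h₁, h₂, h₃, h₄]
    ring

theorem not_concurrent (h : IsSmoothTrilinear T) (h₁ : IsNullLine T W₁) (h₂ : IsNullLine T W₂)
    (h₃ : IsNullLine T W₃) (hne : W₁ ≠ W₂) (hle : ¬W₃ ≤ W₁ ⊔ W₂) {x : V} (hx₁ : x ∈ W₁)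
    (hx₂ : x ∈ W₂) (hx₃ : x ∈ W₃) : x = 0 := by
  have := h.finiteDimensional
  by_contra hx0
  have hP := finrank_sup_eq_three h₁.finrank_eq h₂.finrank_eq hne hx₁ hx₂ hx0
  have htop := sup_eq_top_of_not_le h.finrank_eq hP hle
  refine hx0 (h.eq_zero_of_forall fun y => ?_)
  have hy : y ∈ W₃ ⊔ (W₁ ⊔ W₂) := htop ▸ Submodule.mem_top
  have hker : W₃ ⊔ (W₁ ⊔ W₂) ≤ LinearMap.ker (T x x) :=
    sup_le (fun y hy => h₃.polar h hx₃ hx₃ hy)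
      (sup_le (fun y hy => h₁.polar h hx₁ hx₁ hy) fun y hy => h₂.polar h hx₂ hx₂ hy)
  exact hker hy

theorem exists_third (h : IsSmoothTrilinear T) (h₁ : IsNullLine T W₁) (h₂ : IsNullLine T W₂)
    (hne : W₁ ≠ W₂) {p : V} (hp₁ : p ∈ W₁) (hp₂ : p ∈ W₂) (hp0 : p ≠ 0) :
    ∃ W₃, IsNullLine T W₃ ∧ W₃ ≤ W₁ ⊔ W₂ ∧ W₃ ≠ W₁ ∧ W₃ ≠ W₂ ∧
      ∀ x ∈ W₁ ⊔ W₂, T x x x = 0 → x ∈ W₁ ∨ x ∈ W₂ ∨ x ∈ W₃ := by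
  have := h.finiteDimensional
  have hP := finrank_sup_eq_three h₁.finrank_eq h₂.finrank_eq hne hp₁ hp₂ hp0
  obtain ⟨n, hn⟩ := exists_sub_smul_mem h.finrank_eq hP
  obtain ⟨u, hu, hpu, hspan₁⟩ := exists_pair_of_mem h₁.finrank_eq hp₁ hp0
  obtain ⟨v, hv, hpv, hspan₂⟩ := exists_pair_of_mem h₂.finrank_eq hp₂ hp0
  have hc : ∀ a b c : ℝ, a • p + b • u + c • v ∈ W₁ → c = 0 := fun a b c hm => by
    by_contra hc
    have hcv : c • v ∈ W₁ := by
      simpa using sub_mem hm (add_mem (W₁.smul_mem a hp₁) (W₁.smul_mem b hu))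
    refine hne (eq_of_le_of_finrank_two ?_ h₂.finrank_eq h₁.finrank_eq).symm
    rw [← hspan₂, Submodule.span_le]
    rintro x (rfl | rfl)
    exacts [hp₁, (Submodule.smul_mem_iff _ hc).1 hcv]
  have hb : ∀ a b c : ℝ, a • p + b • u + c • v ∈ W₂ → b = 0 := fun a b c hm => by
    by_contra hb
    have hbu : b • u ∈ W₂ := by
      have := sub_mem hm (add_mem (W₂.smul_mem a hp₂) (W₂.smul_mem c hv))
      rwa [show a • p + b • u + c • v - (a • p + c • v) = b • u by abel] at this
    refine hne (eq_of_le_of_finrank_two ?_ h₁.finrank_eq h₂.finrank_eq)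
    rw [← hspan₁, Submodule.span_le]
    rintro x (rfl | rfl)
    exacts [hp₂, (Submodule.smul_mem_iff _ hb).1 hbu]
  have hker : ∀ {z z'}, (∀ y ∈ W₁, T z z' y = 0) → (∀ y ∈ W₂, T z z' y = 0) →
      ∀ x ∈ W₁ ⊔ W₂, T z z' x = 0 := fun e₁ e₂ x hx =>
    (sup_le (c := LinearMap.ker (T _ _)) e₁ e₂ : W₁ ⊔ W₂ ≤ _) hx
  have hAB : ¬(T p u v = 0 ∧ T u u v = 0) := fun ⟨hA, hB⟩ => by
    refine h.not_double hpu hn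
      (hker (fun y hy => h₁.polar h hp₁ hp₁ hy) fun y hy => h₂.polar h hp₂ hp₂ hy)
      (hker (fun y hy => h₁.polar h hp₁ hu hy) fun y hy => ?_)
      (hker (fun y hy => h₁.polar h hu hu hy) fun y hy => ?_) <;>
    · rw [← hspan₂] at hy
      obtain ⟨a, b, rfl⟩ := Submodule.mem_span_pair.1 hy
      simp [hA, hB, h₁.polar h hp₁ hu hp₁, h₁.polar h hu hu hp₁]
  have hAC : ¬(T p u v = 0 ∧ T u v v = 0) := fun ⟨hA, hC⟩ => by
    refine h.not_double hpv hn
      (hker (fun y hy => h₁.polar h hp₁ hp₁ hy) fun y hy => h₂.polar h hp₂ hp₂ hy)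
      (hker (fun y hy => ?_) fun y hy => h₂.polar h hp₂ hv hy)
      (hker (fun y hy => ?_) fun y hy => h₂.polar h hv hv hy) <;>
    · rw [← hspan₁] at hy
      obtain ⟨a, b, rfl⟩ := Submodule.mem_span_pair.1 hy
      simp [h.swap₂₃ p v u, h.swap₂₃ v v u, h.swap₁₂ v u v, hA, hC, h₂.polar h hp₂ hv hp₂,
        h₂.polar h hv hv hp₂]
  have hF : ∀ a b c : ℝ, T (a • p + b • u + c • v) (a • p + b • u + c • v)
      (a • p + b • u + c • v) =
      3 * b * c * (2 * a * T p u v + b * T u u v + c * T u v v) := fun a b c => by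
    have e₁ := h₁.polar h hp₁ hp₁ hp₁
    have e₂ := h₁.polar h hp₁ hp₁ hu
    have e₃ := h₁.polar h hp₁ hu hu
    have e₄ := h₁.polar h hu hu hu
    have e₅ := h₂.polar h hp₂ hp₂ hv
    have e₆ := h₂.polar h hp₂ hv hv
    have e₇ := h₂.polar h hv hv hv
    simp only [map_add, map_smul, LinearMap.add_apply, LinearMap.smul_apply, smul_eq_mul,
      h.swap₁₂ u p, h.swap₁₂ v p, h.swap₁₂ v u, h.swap₂₃ p u p, h.swap₂₃ p v p, h.swap₂₃ p v u,
      h.swap₂₃ u u p, h.swap₂₃ u v p, h.swap₂₃ u v u, h.swap₂₃ v v p, h.swap₂₃ v v u,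
      e₁, e₂, e₃, e₄, e₅, e₆, e₇]
    ring
  have hP' : ∀ x ∈ W₁ ⊔ W₂, ∃ a b c : ℝ, a • p + b • u + c • v = x := fun x hx => by
    obtain ⟨y, hy, z, hz, rfl⟩ := Submodule.mem_sup.1 hx
    rw [← hspan₁] at hy
    rw [← hspan₂] at hz
    obtain ⟨a, b, rfl⟩ := Submodule.mem_span_pair.1 hy
    obtain ⟨a', c, rfl⟩ := Submodule.mem_span_pair.1 hz
    exact ⟨a + a', b, c, by module⟩
  have hind : ∀ a b c : ℝ, a • p + b • u + c • v = 0 → a = 0 ∧ b = 0 ∧ c = 0 := fun a b c e => by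
    have e₁ := hc a b c (e ▸ W₁.zero_mem)
    have e₂ := hb a b c (e ▸ W₂.zero_mem)
    subst e₁ e₂
    exact ⟨(hpu a 0 (by simpa using e)).1, rfl, rfl⟩
  obtain ⟨a₁, b₁, c₁, a₂, b₂, c₂, hL₁, hL₂, hst, hcov, hb0, hc0⟩ := exists_basis_plane hAB hAC
  have hcomb : ∀ s t : ℝ, s • (a₁ • p + b₁ • u + c₁ • v) + t • (a₂ • p + b₂ • u + c₂ • v) =
      (s * a₁ + t * a₂) • p + (s * b₁ + t * b₂) • u + (s * c₁ + t * c₂) • v := fun s t => by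
    module
  have hmem : ∀ a b c : ℝ, a • p + b • u + c • v ∈ W₁ ⊔ W₂ := fun a b c =>
    Submodule.add_mem_sup (add_mem (W₁.smul_mem a hp₁) (W₁.smul_mem b hu)) (W₂.smul_mem c hv)
  refine ⟨Submodule.span ℝ {a₁ • p + b₁ • u + c₁ • v, a₂ • p + b₂ • u + c₂ • v},
    ⟨finrank_span_pair_eq_two fun s t e => ?_, fun w hw => ?_⟩, ?_, fun e => ?_, fun e => ?_,
    fun x hx hx0 => ?_⟩
  · rw [hcomb] at e
    obtain ⟨e₁, e₂, e₃⟩ := hind _ _ _ e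
    exact hst s t e₁ e₂ e₃
  · obtain ⟨s, t, rfl⟩ := Submodule.mem_span_pair.1 hw
    rw [hcomb, hF]
    linear_combination 3 * (s * b₁ + t * b₂) * (s * c₁ + t * c₂) * (s * hL₁ + t * hL₂)
  · rw [Submodule.span_le]
    rintro x (rfl | rfl) <;> exact hmem _ _ _
  · exact hc0.elim (· (hc a₁ b₁ c₁ (e ▸ Submodule.subset_span (Or.inl rfl))))
      (· (hc a₂ b₂ c₂ (e ▸ Submodule.subset_span (Or.inr rfl))))
  · exact hb0.elim (· (hb a₁ b₁ c₁ (e ▸ Submodule.subset_span (Or.inl rfl))))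
      (· (hb a₂ b₂ c₂ (e ▸ Submodule.subset_span (Or.inr rfl))))
  · obtain ⟨a, b, c, rfl⟩ := hP' x hx
    rw [hF] at hx0
    rcases mul_eq_zero.1 hx0 with hx0 | hx0
    · rcases mul_eq_zero.1 hx0 with hx0 | rfl
      · obtain rfl : b = 0 := by linarith
        exact Or.inr (Or.inl (by
          simpa using add_mem (W₂.smul_mem a hp₂) (W₂.smul_mem c hv)))
      · exact Or.inl (by simpa using add_mem (W₁.smul_mem a hp₁) (W₁.smul_mem b hu))
    · obtain ⟨s, t, rfl, rfl, rfl⟩ := hcov a b c hx0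
      exact Or.inr (Or.inr (Submodule.mem_span_pair.2 ⟨s, t, hcomb s t⟩))

end IsNullLine

end NullLine

section ConicBundle

open Module

variable {V : Type*} [AddCommGroup V] [Module ℝ V] {T : V →ₗ[ℝ] V →ₗ[ℝ] V →ₗ[ℝ] ℝ}

/-- A basis `p, u, n, g` whose first two vectors span a null line of `T`. -/
structure IsFrame (T : V →ₗ[ℝ] V →ₗ[ℝ] V →ₗ[ℝ] ℝ) (p u n g : V) : Prop where
  ppp : T p p p = 0
  ppu : T p p u = 0
  puu : T p u u = 0
  uuu : T u u u = 0
  eq_zero : ∀ α β γ δ : ℝ, α • p + β • u + γ • n + δ • g = 0 → α = 0 ∧ β = 0 ∧ γ = 0 ∧ δ = 0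
  exists_eq : ∀ v, ∃ α β γ δ : ℝ, v = α • p + β • u + γ • n + δ • g

/-- The discriminant of the conic residual to the line `⟨p, u⟩` in the plane `⟨p, u, n⟩`. -/
def conicDisc (T : V →ₗ[ℝ] V →ₗ[ℝ] V →ₗ[ℝ] ℝ) (p u n : V) : ℝ :=
  4 * T n n n * (T p p n * T u u n - T p u n ^ 2) + 6 * T p u n * T p n n * T u n n -
    3 * T p p n * T u n n ^ 2 - 3 * T u u n * T p n n ^ 2

/-- The derivative of `conicDisc T p u` at `n` in the direction `g`. -/
def conicDiscDeriv (T : V →ₗ[ℝ] V →ₗ[ℝ] V →ₗ[ℝ] ℝ) (p u n g : V) : ℝ :=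
  12 * T n n g * (T p p n * T u u n - T p u n ^ 2) +
    4 * T n n n * (T p p g * T u u n + T p p n * T u u g - 2 * T p u n * T p u g) +
    6 * T p u g * T p n n * T u n n + 12 * T p u n * T p n g * T u n n +
    12 * T p u n * T p n n * T u n g - 3 * T p p g * T u n n ^ 2 -
    12 * T p p n * T u n n * T u n g - 3 * T u u g * T p n n ^ 2 -
    12 * T u u n * T p n n * T p n g

/-- `(x, y, z)` lies in the kernel of the matrix of the conic residual to `⟨p, u⟩`
in the plane `⟨p, u, n⟩`. -/
structure IsConicKernel (T : V →ₗ[ℝ] V →ₗ[ℝ] V →ₗ[ℝ] ℝ) (p u n : V) (x y z : ℝ) : Prop where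
  row₀ : 6 * T p p n * x + 6 * T p u n * y + 3 * T p n n * z = 0
  row₁ : 6 * T p u n * x + 6 * T u u n * y + 3 * T u n n * z = 0
  row₂ : 3 * T p n n * x + 3 * T u n n * y + 2 * T n n n * z = 0

theorem exists_isConicKernel {p u n : V} (h : conicDisc T p u n = 0) :
    ∃ x y z, IsConicKernel T p u n x y z ∧ ¬(x = 0 ∧ y = 0 ∧ z = 0) := by
  let M : Matrix (Fin 3) (Fin 3) ℝ := !![6 * T p p n, 6 * T p u n, 3 * T p n n;
    6 * T p u n, 6 * T u u n, 3 * T u n n; 3 * T p n n, 3 * T u n n, 2 * T n n n]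
  have hM : M.det = 0 := by
    rw [Matrix.det_fin_three]
    simp only [M, Matrix.of_apply, Matrix.cons_val]
    unfold conicDisc at h
    linear_combination 18 * h
  obtain ⟨k, hk0, hk⟩ := Matrix.exists_mulVec_eq_zero_iff.2 hM
  refine ⟨k 0, k 1, k 2, ⟨?_, ?_, ?_⟩, fun ⟨h0, h1, h2⟩ => hk0 ?_⟩
  · simpa [M, Matrix.mulVec, dotProduct, Fin.sum_univ_three] using congrFun hk 0
  · simpa [M, Matrix.mulVec, dotProduct, Fin.sum_univ_three] using congrFun hk 1
  · simpa [M, Matrix.mulVec, dotProduct, Fin.sum_univ_three] using congrFun hk 2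
  · ext i; fin_cases i <;> assumption

namespace IsFrame

variable {p u n g : V}

theorem swap (h : IsSmoothTrilinear T) (hF : IsFrame T p u n g) : IsFrame T u p n g where
  ppp := hF.uuu
  ppu := by rw [h.swap₂₃, h.swap₁₂, hF.puu]
  puu := by rw [h.swap₁₂, h.swap₂₃, hF.ppu]
  uuu := hF.ppp
  eq_zero α β γ δ e := by
    have := hF.eq_zero β α γ δ (by rw [← e]; abel)
    tauto
  exists_eq v := by
    obtain ⟨α, β, γ, δ, rfl⟩ := hF.exists_eq v
    exact ⟨β, α, γ, δ, by abel⟩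

theorem swap' (hF : IsFrame T p u n g) : IsFrame T p u g n where
  ppp := hF.ppp
  ppu := hF.ppu
  puu := hF.puu
  uuu := hF.uuu
  eq_zero α β γ δ e := by
    have := hF.eq_zero α β δ γ (by rw [← e]; abel)
    tauto
  exists_eq v := by
    obtain ⟨α, β, γ, δ, rfl⟩ := hF.exists_eq v
    exact ⟨α, β, δ, γ, by abel⟩

theorem add_smul (hF : IsFrame T p u n g) (t : ℝ) : IsFrame T p u (n + t • g) g where
  ppp := hF.ppp
  ppu := hF.ppu
  puu := hF.puu
  uuu := hF.uuu
  eq_zero α β γ δ e := by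
    obtain ⟨h1, h2, h3, h4⟩ := hF.eq_zero α β γ (γ * t + δ) (by rw [← e]; module)
    subst h3
    exact ⟨h1, h2, rfl, by simpa using h4⟩
  exists_eq v := by
    obtain ⟨α, β, γ, δ, rfl⟩ := hF.exists_eq v
    exact ⟨α, β, γ, δ - γ * t, by module⟩

theorem apply_eq (h : IsSmoothTrilinear T) (hF : IsFrame T p u n g)
    (x₀ x₁ x₂ y₀ y₁ y₂ z₀ z₁ z₂ : ℝ) :
    T (x₀ • p + x₁ • u + x₂ • n) (y₀ • p + y₁ • u + y₂ • n) (z₀ • p + z₁ • u + z₂ • n) =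
      (x₀ * y₀ * z₂ + x₀ * y₂ * z₀ + x₂ * y₀ * z₀) * T p p n +
      (x₀ * y₁ * z₂ + x₀ * y₂ * z₁ + x₁ * y₀ * z₂ + x₁ * y₂ * z₀ + x₂ * y₀ * z₁ + x₂ * y₁ * z₀) *
        T p u n +
      (x₁ * y₁ * z₂ + x₁ * y₂ * z₁ + x₂ * y₁ * z₁) * T u u n +
      (x₀ * y₂ * z₂ + x₂ * y₀ * z₂ + x₂ * y₂ * z₀) * T p n n +
      (x₁ * y₂ * z₂ + x₂ * y₁ * z₂ + x₂ * y₂ * z₁) * T u n n +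
      x₂ * y₂ * z₂ * T n n n := by
  simp only [map_add, map_smul, LinearMap.add_apply, LinearMap.smul_apply, smul_eq_mul,
    h.swap₁₂ u p, h.swap₁₂ n p, h.swap₁₂ n u, h.swap₂₃ p u p, h.swap₂₃ p n p, h.swap₂₃ p n u,
    h.swap₂₃ u u p, h.swap₂₃ u n p, h.swap₂₃ u n u, h.swap₂₃ n n p, h.swap₂₃ n n u,
    hF.ppp, hF.ppu, hF.puu, hF.uuu]
  ring

theorem apply_kernel (h : IsSmoothTrilinear T) (hF : IsFrame T p u n g) {x y z x' y' z' : ℝ}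
    (hk : IsConicKernel T p u n x y z) (hk' : IsConicKernel T p u n x' y' z') :
    ∀ w ∈ Submodule.span ℝ {p, u, n},
      T (x • p + y • u + z • n) (x' • p + y' • u + z' • n) w = 0 := by
  intro w hw
  obtain ⟨a, b, c, rfl⟩ := Submodule.mem_span_triple.1 hw
  rw [hF.apply_eq h]
  linear_combination
    (a * z' / 6 + c * x' / 12) * hk.row₀ + (b * z' / 6 + c * y' / 12) * hk.row₁ +
    (c * z' / 4) * hk.row₂ +
    (a * z / 6 + c * x / 12) * hk'.row₀ + (b * z / 6 + c * y / 12) * hk'.row₁ +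
    (c * z / 4) * hk'.row₂

theorem exists_sub_smul_mem (hF : IsFrame T p u n g) (v : V) :
    ∃ c : ℝ, v - c • g ∈ Submodule.span ℝ {p, u, n} := by
  obtain ⟨α, β, γ, δ, rfl⟩ := hF.exists_eq v
  exact ⟨δ, Submodule.mem_span_triple.2 ⟨α, β, γ, by abel⟩⟩

theorem not_independent_kernel (h : IsSmoothTrilinear T) (hF : IsFrame T p u n g)
    {x y z x' y' z' : ℝ} (hk : IsConicKernel T p u n x y z) (hk' : IsConicKernel T p u n x' y' z')
    (hind : ∀ s t : ℝ, s * x + t * x' = 0 → s * y + t * y' = 0 → s * z + t * z' = 0 →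
      s = 0 ∧ t = 0) : False := by
  refine h.not_double (z := x • p + y • u + z • n) (z' := x' • p + y' • u + z' • n)
    (fun s t e => ?_) hF.exists_sub_smul_mem (hF.apply_kernel h hk hk)
    (hF.apply_kernel h hk hk') (hF.apply_kernel h hk' hk')
  obtain ⟨h1, h2, h3, -⟩ := hF.eq_zero (s * x + t * x') (s * y + t * y') (s * z + t * z') 0
    (by rw [← e]; module)
  exact hind s t h1 h2 h3

theorem apply_kernel_ne_zero (h : IsSmoothTrilinear T) (hF : IsFrame T p u n g) {x y z : ℝ}
    (hk : IsConicKernel T p u n x y z) (h0 : ¬(x = 0 ∧ y = 0 ∧ z = 0)) :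
    T (x • p + y • u + z • n) (x • p + y • u + z • n) g ≠ 0 := fun hq => by
  have := h.eq_zero_of_forall (z := x • p + y • u + z • n) fun v => by
    obtain ⟨c, hc⟩ := hF.exists_sub_smul_mem v
    have := hF.apply_kernel h hk hk _ hc
    rwa [map_sub, map_smul, hq, smul_zero, sub_zero] at this
  obtain ⟨h1, h2, h3, -⟩ := hF.eq_zero x y z 0 (by rw [← this]; simp)
  exact h0 ⟨h1, h2, h3⟩

theorem apply_kernel_eq (h : IsSmoothTrilinear T) (x y z : ℝ) :
    T (x • p + y • u + z • n) (x • p + y • u + z • n) g =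
      x ^ 2 * T p p g + 2 * x * y * T p u g + y ^ 2 * T u u g + 2 * x * z * T p n g +
        2 * y * z * T u n g + z ^ 2 * T n n g := by
  simp only [map_add, map_smul, LinearMap.add_apply, LinearMap.smul_apply, smul_eq_mul,
    h.swap₁₂ u p, h.swap₁₂ n p, h.swap₁₂ n u]
  ring

theorem conicDiscDeriv_ne_zero_of_third (h : IsSmoothTrilinear T) (hF : IsFrame T p u n g)
    {x y z : ℝ} (hk : IsConicKernel T p u n x y z) (hz : z ≠ 0) :
    conicDiscDeriv T p u n g ≠ 0 := by
  intro hD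
  have hq := hF.apply_kernel_ne_zero h hk (fun h0 => hz h0.2.2)
  rw [apply_kernel_eq h] at hq
  unfold conicDiscDeriv at hD
  obtain ⟨r₀, r₁, r₂⟩ := id hk
  set a := T p p n
  set b := T p u n
  set c := T u u n
  set d := T p n n
  set e := T u n n
  set f := T n n n
  have h02 : (b * e - d * c) * z = 2 * (a * c - b ^ 2) * x := by
    linear_combination (b * r₁ - c * r₀) / 3
  have h12 : (b * d - a * e) * z = 2 * (a * c - b ^ 2) * y := by
    linear_combination (b * r₀ - a * r₁) / 3
  have h00 : (4 * c * f - 3 * e ^ 2) * z = 6 * (b * e - d * c) * x := by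
    linear_combination 2 * c * r₂ - e * r₁
  have h11 : (4 * a * f - 3 * d ^ 2) * z = 6 * (b * d - a * e) * y := by
    linear_combination 2 * a * r₂ - d * r₀
  have h01 : (3 * d * e - 4 * b * f) * z = 6 * (b * d - a * e) * x := by
    linear_combination e * r₀ - 2 * b * r₂
  have hmin : a * c - b ^ 2 = 0 := by
    refine (mul_eq_zero.1 (?_ : (a * c - b ^ 2) * _ = 0)).resolve_right hq
    linear_combination z ^ 2 / 12 * hD - T p p g / 12 * (z * h00 + 6 * x * h02) -
      T u u g / 12 * (z * h11 + 6 * y * h12) - T p u g / 6 * (z * h01 + 6 * x * h12) -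
      T p n g * z * h02 - T u n g * z * h12
  obtain ⟨α, β, hαβ, e₁, e₂⟩ : ∃ α β : ℝ, ¬(α = 0 ∧ β = 0) ∧ a * α + b * β = 0 ∧
      b * α + c * β = 0 := by
    by_cases hab : a = 0 ∧ b = 0
    · exact ⟨1, 0, by simp, by simp [hab], by simp [hab]⟩
    · exact ⟨-b, a, fun h => hab ⟨h.2, neg_eq_zero.1 h.1⟩, by ring, by linear_combination hmin⟩
  refine hF.not_independent_kernel h hk (x' := α) (y' := β) (z' := 0)
    ⟨by linear_combination 6 * e₁, by linear_combination 6 * e₂, ?_⟩ fun s t h1 h2 h3 => ?_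
  · refine (mul_eq_zero.1 (?_ : z * _ = 0)).resolve_left hz
    linear_combination α * r₀ + β * r₁ - 6 * x * e₁ - 6 * y * e₂
  · obtain rfl : s = 0 := by simpa [hz] using h3
    refine ⟨rfl, ?_⟩
    by_contra ht
    exact hαβ (by simpa [ht] using And.intro h1 h2)

theorem conicDiscDeriv_ne_zero_of_first (h : IsSmoothTrilinear T) (hF : IsFrame T p u n g)
    {x y z : ℝ} (hk : IsConicKernel T p u n x y z) (hx : x ≠ 0) :
    conicDiscDeriv T p u n g ≠ 0 := by
  intro hD
  have hq := hF.apply_kernel_ne_zero h hk (fun h0 => hx h0.1)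
  rw [apply_kernel_eq h] at hq
  unfold conicDiscDeriv at hD
  obtain ⟨r₀, r₁, r₂⟩ := id hk
  set a := T p p n
  set b := T p u n
  set c := T u u n
  set d := T p n n
  set e := T u n n
  set f := T n n n
  have h02 : 6 * (b * e - d * c) * x = (4 * c * f - 3 * e ^ 2) * z := by
    linear_combination e * r₁ - 2 * c * r₂
  have h01 : (3 * d * e - 4 * b * f) * x = (4 * c * f - 3 * e ^ 2) * y := by
    linear_combination e * r₂ - 2 / 3 * f * r₁
  have h11 : (4 * a * f - 3 * d ^ 2) * x = (3 * d * e - 4 * b * f) * y := by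
    linear_combination 2 / 3 * f * r₀ - d * r₂
  have h12 : 6 * (b * d - a * e) * x = (3 * d * e - 4 * b * f) * z := by
    linear_combination 2 * b * r₂ - e * r₀
  have h22 : 2 * (a * c - b ^ 2) * x = (b * e - d * c) * z := by
    linear_combination (c * r₀ - b * r₁) / 3
  have hmin : 4 * c * f - 3 * e ^ 2 = 0 := by
    refine (mul_eq_zero.1 (?_ : (4 * c * f - 3 * e ^ 2) * _ = 0)).resolve_right hq
    linear_combination x ^ 2 * hD - T u u g * (x * h11 + y * h01) - 2 * T p u g * x * h01 -
      2 * T p n g * x * h02 - 2 * T u n g * (x * h12 + z * h01) -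
      T n n g * (6 * x * h22 + z * h02)
  obtain ⟨α, β, hαβ, e₁, e₂⟩ : ∃ α β : ℝ, ¬(α = 0 ∧ β = 0) ∧ 2 * c * α + e * β = 0 ∧
      3 * e * α + 2 * f * β = 0 := by
    by_cases hce : c = 0 ∧ e = 0
    · exact ⟨1, 0, by simp, by simp [hce], by simp [hce]⟩
    · exact ⟨-e, 2 * c, fun h => hce ⟨by simpa using h.2, neg_eq_zero.1 h.1⟩, by ring,
        by linear_combination hmin⟩
  refine hF.not_independent_kernel h hk (x' := 0) (y' := α) (z' := β)
    ⟨?_, by linear_combination 3 * e₁, by linear_combination e₂⟩ fun s t h1 h2 h3 => ?_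
  · refine (mul_eq_zero.1 (?_ : x * _ = 0)).resolve_left hx
    linear_combination α * r₁ + β * r₂ - 3 * y * e₁ - z * e₂
  · obtain rfl : s = 0 := by simpa [hx] using h1
    refine ⟨rfl, ?_⟩
    by_contra ht
    exact hαβ (by simpa [ht] using And.intro h2 h3)

theorem conicDiscDeriv_ne_zero (h : IsSmoothTrilinear T) (hF : IsFrame T p u n g)
    (hD : conicDisc T p u n = 0) : conicDiscDeriv T p u n g ≠ 0 := by
  obtain ⟨x, y, z, hk, h0⟩ := exists_isConicKernel hD
  by_cases hz : z = 0
  · by_cases hx : x = 0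
    · have hy : y ≠ 0 := fun hy => h0 ⟨hx, hy, hz⟩
      have hk' : IsConicKernel T u p n y x z := by
        obtain ⟨r₀, r₁, r₂⟩ := hk
        exact ⟨by rw [h.swap₁₂ u p]; linarith, by rw [h.swap₁₂ u p]; linarith, by linarith⟩
      have := (hF.swap h).conicDiscDeriv_ne_zero_of_first h hk' hy
      unfold conicDiscDeriv at this ⊢
      simp only [h.swap₁₂ u p] at this
      exact fun e => this (by linear_combination e)
    · exact hF.conicDiscDeriv_ne_zero_of_first h hk hx
  · exact hF.conicDiscDeriv_ne_zero_of_third h hk hz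

end IsFrame

end ConicBundle

section ConicDiscriminant

open Module

section Polynomial

open Polynomial Filter

theorem exists_isRoot_of_odd_natDegree {q : ℝ[X]} (hq : Odd q.natDegree) :
    ∃ x, q.IsRoot x := by
  wlog hlead : 0 ≤ q.leadingCoeff generalizing q
  · obtain ⟨x, hx⟩ := this (q := -q) (by simpa using hq)
      (by rw [leadingCoeff_neg]; linarith)
    exact ⟨x, by simpa using hx⟩
  have hdeg : 0 < q.natDegree := hq.pos
  have h₁ : Tendsto (fun x => eval x q) atTop atTop :=
    q.tendsto_atTop_of_leadingCoeff_nonneg (natDegree_pos_iff_degree_pos.1 hdeg) hlead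
  have h₂ : Tendsto (fun x => eval x (q.comp (-Polynomial.X))) atTop atBot := by
    refine tendsto_atBot_of_leadingCoeff_nonpos _ (natDegree_pos_iff_degree_pos.1 ?_) ?_
    · rwa [natDegree_comp, natDegree_neg, natDegree_X, mul_one]
    · rw [leadingCoeff_comp (by simp), leadingCoeff_neg, leadingCoeff_X, hq.neg_one_pow]
      linarith
  obtain ⟨x, hx⟩ := (h₁.eventually_ge_atTop 0).exists
  obtain ⟨y, hy⟩ := (h₂.eventually_le_atBot 0).exists
  exact mem_range_of_exists_le_of_exists_ge q.continuous ⟨-y, by simpa using hy⟩ ⟨x, hx⟩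

theorem odd_card_roots {q : ℝ[X]} (hq : Odd q.natDegree) : Odd q.roots.card := by
  have hq0 : q ≠ 0 := by rintro rfl; simp at hq
  obtain ⟨r, hr, hdeg, hroots⟩ := q.exists_prod_multiset_X_sub_C_mul
  rcases Nat.even_or_odd r.natDegree with he | ho
  · by_contra hc
    rw [← hdeg] at hq
    exact Nat.not_even_iff_odd.2 hq ((Nat.not_odd_iff_even.1 hc).add he)
  · obtain ⟨x, hx⟩ := exists_isRoot_of_odd_natDegree ho
    have hr0 : r ≠ 0 := by rintro rfl; simp at ho
    have := (mem_roots hr0).2 hx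
    simp [hroots] at this

theorem card_roots_of_natDegree_eq_five {q : ℝ[X]} (hq : q.natDegree = 5)
    (hs : ∀ t, q.eval t = 0 → q.derivative.eval t ≠ 0) :
    q.roots.toFinset.card ∈ ({1, 3, 5} : Set ℕ) := by
  have hq0 : q ≠ 0 := by rintro rfl; simp at hq
  have hnodup : q.roots.Nodup := by
    refine Multiset.nodup_iff_count_le_one.2 fun t => ?_
    rw [count_roots]
    by_contra! hc
    obtain ⟨h1, h2⟩ := (one_lt_rootMultiplicity_iff_isRoot hq0).1 hc
    exact hs t h1 h2
  rw [Multiset.toFinset_card_of_nodup hnodup]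
  have hle := q.card_roots'
  have hodd := odd_card_roots (q := q) (by rw [hq]; decide)
  rw [hq] at hle
  obtain ⟨k, hk⟩ := hodd
  simp only [Set.mem_insert_iff, Set.mem_singleton_iff]
  omega

end Polynomial

variable {V : Type*} [AddCommGroup V] [Module ℝ V] {T : V →ₗ[ℝ] V →ₗ[ℝ] V →ₗ[ℝ] ℝ}

open Polynomial in
/-- The polynomial `t ↦ conicDisc T p u (n + t g)`. -/
noncomputable def conicDiscPoly (T : V →ₗ[ℝ] V →ₗ[ℝ] V →ₗ[ℝ] ℝ) (p u n g : V) : ℝ[X] :=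
  4 * (.C (T n n n) + 3 * .C (T n n g) * .X + 3 * .C (T n g g) * .X ^ 2 + .C (T g g g) * .X ^ 3) *
      ((.C (T p p n) + .C (T p p g) * .X) * (.C (T u u n) + .C (T u u g) * .X) -
        (.C (T p u n) + .C (T p u g) * .X) ^ 2) +
    6 * (.C (T p u n) + .C (T p u g) * .X) *
      (.C (T p n n) + 2 * .C (T p n g) * .X + .C (T p g g) * .X ^ 2) *
      (.C (T u n n) + 2 * .C (T u n g) * .X + .C (T u g g) * .X ^ 2) -
    3 * (.C (T p p n) + .C (T p p g) * .X) *
      (.C (T u n n) + 2 * .C (T u n g) * .X + .C (T u g g) * .X ^ 2) ^ 2 -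
    3 * (.C (T u u n) + .C (T u u g) * .X) *
      (.C (T p n n) + 2 * .C (T p n g) * .X + .C (T p g g) * .X ^ 2) ^ 2

theorem eval_conicDiscPoly (h : IsSmoothTrilinear T) (p u n g : V) (t : ℝ) :
    (conicDiscPoly T p u n g).eval t = conicDisc T p u (n + t • g) := by
  simp only [conicDisc, conicDiscPoly, Polynomial.eval_add, Polynomial.eval_sub,
    Polynomial.eval_mul, Polynomial.eval_pow, Polynomial.eval_C, Polynomial.eval_X,
    Polynomial.eval_ofNat, map_add, map_smul, LinearMap.add_apply, LinearMap.smul_apply,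
    smul_eq_mul, h.swap₂₃ p g n, h.swap₂₃ u g n, h.swap₁₂ g n, h.swap₂₃ g g n, h.swap₂₃ n g n]
  ring

theorem eval_derivative_conicDiscPoly (h : IsSmoothTrilinear T) (p u n g : V) (t : ℝ) :
    (conicDiscPoly T p u n g).derivative.eval t = conicDiscDeriv T p u (n + t • g) g := by
  simp only [conicDiscDeriv, conicDiscPoly, map_add, map_sub, Polynomial.derivative_mul,
    Polynomial.derivative_pow, Polynomial.derivative_C, Polynomial.derivative_X,
    Polynomial.derivative_ofNat, Polynomial.eval_add, Polynomial.eval_sub,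
    Polynomial.eval_mul, Polynomial.eval_pow, Polynomial.eval_C, Polynomial.eval_X,
    Polynomial.eval_ofNat, map_smul, LinearMap.add_apply, LinearMap.smul_apply,
    smul_eq_mul, h.swap₂₃ p g n, h.swap₂₃ u g n, h.swap₁₂ g n, h.swap₂₃ g g n, h.swap₂₃ n g n,
    Polynomial.eval_zero, Polynomial.eval_one]
  push_cast
  ring

theorem natDegree_conicDiscPoly_le (p u n g : V) : (conicDiscPoly T p u n g).natDegree ≤ 5 := by
  unfold conicDiscPoly
  compute_degree

theorem coeff_conicDiscPoly (p u n g : V) :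
    (conicDiscPoly T p u n g).coeff 5 = conicDisc T p u g := by
  unfold conicDiscPoly conicDisc
  compute_degree
  all_goals first | ring1 | norm_num

end ConicDiscriminant

section SingularParams

open Module

variable {V : Type*} [AddCommGroup V] [Module ℝ V] {T : V →ₗ[ℝ] V →ₗ[ℝ] V →ₗ[ℝ] ℝ}

namespace IsFrame

variable {p u n g : V}

theorem exists_conicDisc_ne_zero (h : IsSmoothTrilinear T) (hF : IsFrame T p u n g) :
    ∃ g', IsFrame T p u n g' ∧ conicDisc T p u g' ≠ 0 := by
  by_cases hD : conicDisc T p u g = 0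
  · have hq : conicDiscPoly T p u g n ≠ 0 := fun hq => by
      refine hF.swap'.conicDiscDeriv_ne_zero h hD ?_
      have := eval_derivative_conicDiscPoly h p u g n 0
      rw [hq] at this
      simpa using this.symm
    obtain ⟨t, ht⟩ : ∃ t, (conicDiscPoly T p u g n).eval t ≠ 0 := by
      by_contra! hc
      exact hq (Polynomial.funext fun t => by simpa using hc t)
    rw [eval_conicDiscPoly h] at ht
    exact ⟨g + t • n, (hF.swap'.add_smul t).swap', ht⟩
  · exact ⟨g, hF, hD⟩

/-- The planes through `⟨p, u⟩` with singular residual conic. -/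
noncomputable def singularParams (T : V →ₗ[ℝ] V →ₗ[ℝ] V →ₗ[ℝ] ℝ) (p u n g : V) : Finset ℝ :=
  (conicDiscPoly T p u n g).roots.toFinset

theorem natDegree_conicDiscPoly (hD : conicDisc T p u g ≠ 0) :
    (conicDiscPoly T p u n g).natDegree = 5 :=
  le_antisymm (natDegree_conicDiscPoly_le p u n g)
    (Polynomial.le_natDegree_of_ne_zero (by rwa [coeff_conicDiscPoly]))

theorem mem_singularParams (h : IsSmoothTrilinear T) (hD : conicDisc T p u g ≠ 0) {t : ℝ} :
    t ∈ singularParams T p u n g ↔ conicDisc T p u (n + t • g) = 0 := by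
  have hq : conicDiscPoly T p u n g ≠ 0 := fun hq => by
    have := natDegree_conicDiscPoly (n := n) hD
    simp [hq] at this
  rw [singularParams, Multiset.mem_toFinset, Polynomial.mem_roots hq, Polynomial.IsRoot,
    eval_conicDiscPoly h]

theorem card_singularParams (h : IsSmoothTrilinear T) (hF : IsFrame T p u n g)
    (hD : conicDisc T p u g ≠ 0) : (singularParams T p u n g).card ∈ ({1, 3, 5} : Set ℕ) := by
  refine card_roots_of_natDegree_eq_five (natDegree_conicDiscPoly hD) fun t ht => ?_
  rw [eval_conicDiscPoly h] at ht
  rw [eval_derivative_conicDiscPoly h]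
  exact (hF.add_smul t).conicDiscDeriv_ne_zero h ht

theorem conicDisc_comb (h : IsSmoothTrilinear T) (hF : IsFrame T p u n g) (α β γ : ℝ) :
    conicDisc T p u (α • p + β • u + γ • n) = γ ^ 5 * conicDisc T p u n := by
  simp only [conicDisc, map_add, map_smul, LinearMap.add_apply, LinearMap.smul_apply, smul_eq_mul,
    h.swap₁₂ u p, h.swap₁₂ n p, h.swap₁₂ n u, h.swap₂₃ p u p, h.swap₂₃ p n p, h.swap₂₃ p n u,
    h.swap₂₃ u u p, h.swap₂₃ u n p, h.swap₂₃ u n u, h.swap₂₃ n n p, h.swap₂₃ n n u,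
    hF.ppp, hF.ppu, hF.puu, hF.uuu]
  ring

end IsFrame

theorem conicDisc_eq_zero_of_null (h : IsSmoothTrilinear T) {p u y : V} {α β : ℝ}
    (hαβ : ¬(α = 0 ∧ β = 0)) (h₁ : T (α • p + β • u) (α • p + β • u) y = 0)
    (h₂ : T (α • p + β • u) y y = 0) (h₃ : T y y y = 0) : conicDisc T p u y = 0 := by
  simp only [map_add, map_smul, LinearMap.add_apply, LinearMap.smul_apply, smul_eq_mul,
    h.swap₁₂ u p] at h₁ h₂
  unfold conicDisc
  by_cases hα : α = 0
  · have hβ : β ≠ 0 := fun hβ => hαβ ⟨hα, hβ⟩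
    refine (mul_eq_zero.1 (?_ : β ^ 2 * _ = 0)).resolve_left (pow_ne_zero 2 hβ)
    subst hα
    have e₁ : T u u y = 0 := by simpa [hβ] using h₁
    have e₂ : T u y y = 0 := by simpa [hβ] using h₂
    rw [e₁, e₂, h₃]
    ring
  · refine (mul_eq_zero.1 (?_ : α ^ 2 * _ = 0)).resolve_left (pow_ne_zero 2 hα)
    rw [h₃]
    linear_combination -3 * T u y y ^ 2 * h₁ + (6 * α * T p u y * T u y y -
      3 * T u u y * (α * T p y y - β * T u y y)) * h₂

namespace IsNullLine

variable {W ℓ : Submodule ℝ V}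

theorem exists_frame (h : IsSmoothTrilinear T) (hℓ : IsNullLine T ℓ) :
    ∃ p u n g, IsFrame T p u n g ∧ conicDisc T p u g ≠ 0 ∧ Submodule.span ℝ {p, u} = ℓ := by
  have := h.finiteDimensional
  obtain ⟨W, hW⟩ := exists_isCompl ℓ
  have hW2 : finrank ℝ W = 2 := by
    have := Submodule.finrank_add_eq_of_isCompl hW
    rw [h.finrank_eq, hℓ.finrank_eq] at this
    omega
  have hne : ∀ {U : Submodule ℝ V}, finrank ℝ U = 2 → U ≠ ⊥ := by
    rintro U hU rfl
    simp at hU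
  obtain ⟨p, hp, hp0⟩ := Submodule.exists_mem_ne_zero_of_ne_bot (hne hℓ.finrank_eq)
  obtain ⟨n, hn, hn0⟩ := Submodule.exists_mem_ne_zero_of_ne_bot (hne hW2)
  obtain ⟨u, hu, hpu, hspan⟩ := exists_pair_of_mem hℓ.finrank_eq hp hp0
  obtain ⟨g, hg, hng, hspan'⟩ := exists_pair_of_mem hW2 hn hn0
  have hF : IsFrame T p u n g :=
    { ppp := hℓ.polar h hp hp hp
      ppu := hℓ.polar h hp hp hu
      puu := hℓ.polar h hp hu hu
      uuu := hℓ.polar h hu hu hu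
      eq_zero := fun α β γ δ e => by
        have hm : α • p + β • u ∈ ℓ := add_mem (ℓ.smul_mem α hp) (ℓ.smul_mem β hu)
        have hm' : γ • n + δ • g ∈ W := add_mem (W.smul_mem γ hn) (W.smul_mem δ hg)
        have e' : α • p + β • u = -(γ • n + δ • g) := eq_neg_of_add_eq_zero_left (by rw [← e]; abel)
        have h0 : α • p + β • u = 0 :=
          (Submodule.disjoint_def.1 hW.disjoint) _ hm (e' ▸ W.neg_mem hm')
        have h0' : γ • n + δ • g = 0 := by rwa [h0, eq_comm, neg_eq_zero] at e'
        obtain ⟨h1, h2⟩ := hpu _ _ h0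
        obtain ⟨h3, h4⟩ := hng _ _ h0'
        exact ⟨h1, h2, h3, h4⟩
      exists_eq := fun v => by
        obtain ⟨y, hy, z, hz, rfl⟩ := Submodule.mem_sup.1
          (hW.sup_eq_top ▸ Submodule.mem_top : v ∈ ℓ ⊔ W)
        rw [← hspan] at hy
        rw [← hspan'] at hz
        obtain ⟨α, β, rfl⟩ := Submodule.mem_span_pair.1 hy
        obtain ⟨γ, δ, rfl⟩ := Submodule.mem_span_pair.1 hz
        exact ⟨α, β, γ, δ, by abel⟩ }
  obtain ⟨g', hF', hD⟩ := hF.exists_conicDisc_ne_zero h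
  exact ⟨p, u, n, g', hF', hD, hspan⟩

end IsNullLine

namespace IsFrame

variable {p u n g : V} {W : Submodule ℝ V}

theorem finrank_plane (hF : IsFrame T p u n g) :
    finrank ℝ (Submodule.span ℝ {p, u, n}) = 3 := by
  have hli : LinearIndependent ℝ ![p, u, n] := Fintype.linearIndependent_iff.2 fun c hc i => by
    rw [Fin.sum_univ_three] at hc
    obtain ⟨h0, h1, h2, -⟩ := hF.eq_zero (c 0) (c 1) (c 2) 0 (by simpa using hc)
    fin_cases i <;> assumption
  have := finrank_span_eq_card hli
  rw [show Set.range ![p, u, n] = {p, u, n} by ext; simp; tauto] at this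
  simpa using this

theorem finrank_line (hF : IsFrame T p u n g) :
    finrank ℝ (Submodule.span ℝ {p, u}) = 2 :=
  finrank_span_pair_eq_two fun α β e => by
    have := hF.eq_zero α β 0 0 (by simpa using e)
    tauto

theorem exists_param (h : IsSmoothTrilinear T) (hF : IsFrame T p u n g)
    (hD : conicDisc T p u g ≠ 0) (hW : IsNullLine T W) (hne : W ≠ Submodule.span ℝ {p, u})
    (hmeet : W ⊓ Submodule.span ℝ {p, u} ≠ ⊥) :
    ∃ t ∈ singularParams T p u n g, W ≤ Submodule.span ℝ {p, u, n + t • g} := by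
  have := h.finiteDimensional
  obtain ⟨x, ⟨hxW, hx⟩, hx0⟩ := Submodule.exists_mem_ne_zero_of_ne_bot hmeet
  obtain ⟨α, β, rfl⟩ := Submodule.mem_span_pair.1 hx
  obtain ⟨y, hyW, hxy, hspan⟩ := exists_pair_of_mem hW.finrank_eq hxW hx0
  have hDy := conicDisc_eq_zero_of_null h (fun h0 => hx0 (by simp [h0]))
    (hW.polar h hxW hxW hyW) (hW.polar h hxW hyW hyW) (hW.polar h hyW hyW hyW)
  obtain ⟨α', β', γ, δ, rfl⟩ := hF.exists_eq y
  have hγ : γ ≠ 0 := fun hγ => by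
    subst hγ
    rw [zero_smul, add_zero, hF.swap'.conicDisc_comb h] at hDy
    have hδ : δ = 0 := by simpa [hD] using hDy
    subst hδ
    refine hne (Submodule.eq_of_le_of_finrank_eq ?_ (hW.finrank_eq.trans hF.finrank_line.symm))
    rw [← hspan, Submodule.span_le]
    rintro z (rfl | rfl)
    · exact hx
    · exact Submodule.mem_span_pair.2 ⟨α', β', by simp⟩
  have e : α' • p + β' • u + γ • n + δ • g = α' • p + β' • u + γ • (n + (δ / γ) • g) := by
    rw [smul_add, smul_smul, mul_div_cancel₀ _ hγ, add_assoc _ (γ • n)]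
  rw [e] at hDy hspan
  rw [(hF.add_smul _).conicDisc_comb h] at hDy
  refine ⟨δ / γ, (mem_singularParams h hD).2 (by simpa [hγ] using hDy), ?_⟩
  rw [← hspan, Submodule.span_le]
  rintro z (rfl | rfl)
  · exact Submodule.mem_span_triple.2 ⟨α, β, 0, by simp⟩
  · exact Submodule.mem_span_triple.2 ⟨α', β', γ, rfl⟩

theorem param_unique (hF : IsFrame T p u n g) (hW : finrank ℝ W = 2)
    (hne : W ≠ Submodule.span ℝ {p, u}) {s t : ℝ}
    (hs : W ≤ Submodule.span ℝ {p, u, n + s • g}) (ht : W ≤ Submodule.span ℝ {p, u, n + t • g}) :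
    s = t := by
  have : FiniteDimensional ℝ (Submodule.span ℝ {p, u}) :=
    .of_finrank_pos (by rw [hF.finrank_line]; norm_num)
  by_contra hst
  refine hne (Submodule.eq_of_le_of_finrank_eq (fun x hx => ?_) (hW.trans hF.finrank_line.symm))
  obtain ⟨a, b, c, rfl⟩ := Submodule.mem_span_triple.1 (hs hx)
  obtain ⟨a', b', c', e⟩ := Submodule.mem_span_triple.1 (ht hx)
  obtain ⟨-, -, h3, h4⟩ := hF.eq_zero (a - a') (b - b') (c - c') (c * s - c' * t) (by
    rw [← sub_eq_zero.2 e.symm]; module)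
  obtain rfl : c = c' := sub_eq_zero.1 h3
  have hc : c = 0 := by
    have : c * (s - t) = 0 := by linear_combination h4
    simpa [sub_ne_zero.2 hst] using this
  exact Submodule.mem_span_pair.2 ⟨a, b, by simp [hc]⟩

theorem exists_null_or_forall_meet (h : IsSmoothTrilinear T) (hF : IsFrame T p u n g)
    (hD : conicDisc T p u n = 0) :
    (∃ W, IsNullLine T W ∧ W ≠ Submodule.span ℝ {p, u} ∧ W ≤ Submodule.span ℝ {p, u, n}) ∨
      ∀ W, IsNullLine T W → W ⊓ Submodule.span ℝ {p, u} ≠ ⊥ := by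
  have := h.finiteDimensional
  by_contra! hcon
  obtain ⟨hempty, W, hW, hdisj⟩ := hcon
  obtain ⟨x, y, z, hk, h0⟩ := exists_isConicKernel hD
  have hP := hF.finrank_plane
  set P := Submodule.span ℝ {p, u, n} with hPdef
  have hlP : Submodule.span ℝ {p, u} ≤ P := Submodule.span_mono (by simp [Set.insert_subset_iff])
  have hnle : ¬W ≤ P := fun hle => by
    obtain ⟨w, hw, hw', hw0⟩ := exists_mem_inf_ne_zero hle hlP
      (by rw [hP, hW.finrank_eq, hF.finrank_line]; norm_num)
    exact hw0 ((Submodule.mem_bot ℝ).1 (hdisj ▸ ⟨hw, hw'⟩))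
  obtain ⟨w, hw, hwP, hw0⟩ := exists_mem_inf_ne_zero (U := W) (W := P) le_top le_top
    (by rw [finrank_top, h.finrank_eq, hP, hW.finrank_eq]; norm_num)
  have hwl : w ∉ Submodule.span ℝ {p, u} := fun hwl =>
    hw0 ((Submodule.mem_bot ℝ).1 (hdisj ▸ ⟨hw, hwl⟩))
  have hZ := hF.apply_kernel h hk hk
  have hZP : x • p + y • u + z • n ∈ P := Submodule.mem_span_triple.2 ⟨x, y, z, rfl⟩
  have hZ0 : x • p + y • u + z • n ≠ 0 := fun e => by
    have := hF.eq_zero x y z 0 (by simpa using e)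
    tauto
  by_cases hli : ∀ s t : ℝ, s • (x • p + y • u + z • n) + t • w = 0 → s = 0 ∧ t = 0
  · have hZww : T (x • p + y • u + z • n) w w = 0 := by
      obtain ⟨a, b, c, rfl⟩ := Submodule.mem_span_triple.1 hwP
      have hc : c ≠ 0 := fun hc => hwl (Submodule.mem_span_pair.2 ⟨a, b, by simp [hc]⟩)
      have hnull := hW.null _ hw
      rw [hF.apply_eq h] at hnull ⊢
      refine (mul_eq_zero.1 (?_ : (3 * c) * _ = 0)).resolve_left (by simpa)
      linear_combination z * hnull + c ^ 2 * (a * hk.row₀ + b * hk.row₁ + c * hk.row₂)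
    refine hempty _ (IsNullLine.span_pair h hli (hZ _ hZP) (hZ _ hwP) hZww (hW.null _ hw))
      (fun e => hwl (e ▸ Submodule.subset_span (Or.inr rfl))) ?_
    rw [Submodule.span_le]
    rintro v (rfl | rfl) <;> assumption
  · rw [← LinearIndependent.pair_iff, LinearIndependent.pair_iff' hZ0] at hli
    push Not at hli
    obtain ⟨c, rfl⟩ := hli
    refine hw0 (h.eq_zero_of_forall fun v => ?_)
    have hv : v ∈ W ⊔ P := sup_eq_top_of_not_le h.finrank_eq hP hnle ▸ Submodule.mem_top
    refine (sup_le (c := LinearMap.ker (T _ _)) (fun v hv => hW.polar h hw hw hv)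
      (fun v hv => ?_) : W ⊔ P ≤ _) hv
    simp only [LinearMap.mem_ker, map_smul, LinearMap.smul_apply, hZ v hv, smul_zero]

end IsFrame

end SingularParams

section NullLineGraph

open Module

variable {V : Type*} [AddCommGroup V] [Module ℝ V] {T : V →ₗ[ℝ] V →ₗ[ℝ] V →ₗ[ℝ] ℝ}

theorem inf_ne_bot_iff {U W : Submodule ℝ V} : U ⊓ W ≠ ⊥ ↔ ∃ x, x ∈ U ∧ x ∈ W ∧ x ≠ 0 := by
  simp [Submodule.ne_bot_iff, and_assoc]

theorem inf_ne_bot_of_le [FiniteDimensional ℝ V] {U W P : Submodule ℝ V} (hU : finrank ℝ U = 2)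
    (hW : finrank ℝ W = 2) (hP : finrank ℝ P = 3) (hUP : U ≤ P) (hWP : W ≤ P) : U ⊓ W ≠ ⊥ :=
  inf_ne_bot_iff.2 (exists_mem_inf_ne_zero hUP hWP (by omega))

namespace IsNullLine

variable {W₁ W₂ : Submodule ℝ V}

theorem ne_bot (h₁ : IsNullLine T W₁) : W₁ ≠ ⊥ := by
  rintro rfl
  simpa using h₁.finrank_eq

/-- Two meeting null lines span a plane which contains precisely one further null line. -/
theorem exists_third_of_inf_ne_bot (h : IsSmoothTrilinear T) (h₁ : IsNullLine T W₁)
    (h₂ : IsNullLine T W₂) (hne : W₁ ≠ W₂) (hmeet : W₁ ⊓ W₂ ≠ ⊥) :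
    ∃ W₃, IsNullLine T W₃ ∧ W₃ ≤ W₁ ⊔ W₂ ∧ W₃ ≠ W₁ ∧ W₃ ≠ W₂ ∧
      (∀ W, IsNullLine T W → ∃ x ∈ W, x ≠ 0 ∧ (x ∈ W₁ ∨ x ∈ W₂ ∨ x ∈ W₃)) ∧
      ∀ W, IsNullLine T W → W ≤ W₁ ⊔ W₂ → W = W₁ ∨ W = W₂ ∨ W = W₃ := by
  have := h.finiteDimensional
  obtain ⟨p, hp₁, hp₂, hp0⟩ := inf_ne_bot_iff.1 hmeet
  have hP := finrank_sup_eq_three h₁.finrank_eq h₂.finrank_eq hne hp₁ hp₂ hp0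
  obtain ⟨W₃, h₃, hle, h31, h32, hall⟩ := h₁.exists_third h h₂ hne hp₁ hp₂ hp0
  refine ⟨W₃, h₃, hle, h31, h32, fun W hW => ?_, fun W hW hWP => ?_⟩
  · obtain ⟨x, hxW, hxP, hx0⟩ := exists_mem_inf_ne_zero (U := W) (W := W₁ ⊔ W₂) le_top le_top
      (by rw [finrank_top, h.finrank_eq, hP, hW.finrank_eq]; norm_num)
    exact ⟨x, hxW, hx0, hall x hxP (hW.null x hxW)⟩
  · exact (le_of_subset_union fun x hx => hall x (hWP hx) (hW.null x hx)).imp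
      (eq_of_le_of_finrank_two · hW.finrank_eq h₁.finrank_eq)
      (.imp (eq_of_le_of_finrank_two · hW.finrank_eq h₂.finrank_eq)
        (eq_of_le_of_finrank_two · hW.finrank_eq h₃.finrank_eq))

/-- A null line outside a plane meets at most one of the null lines of that plane. -/
theorem not_meet_both (h : IsSmoothTrilinear T) (h₁ : IsNullLine T W₁) (h₂ : IsNullLine T W₂)
    {W P : Submodule ℝ V} (hW : IsNullLine T W) (hne : W₁ ≠ W₂) (h₁P : W₁ ≤ P) (h₂P : W₂ ≤ P)
    (hWP : ¬W ≤ P) (hm₁ : W ⊓ W₁ ≠ ⊥) : ¬W ⊓ W₂ ≠ ⊥ := fun hm₂ => by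
  have := h.finiteDimensional
  obtain ⟨x, hxW, hx₁, hx0⟩ := inf_ne_bot_iff.1 hm₁
  obtain ⟨y, hyW, hy₂, hy0⟩ := inf_ne_bot_iff.1 hm₂
  obtain ⟨c, rfl⟩ := exists_smul_eq_of_finrank_lt hW.finrank_eq hWP hxW (h₁P hx₁) hx0 hyW (h₂P hy₂)
  exact hy0 (h₁.not_concurrent h h₂ hW hne (fun hle => hWP (hle.trans (sup_le h₁P h₂P)))
    (W₁.smul_mem c hx₁) hy₂ (W.smul_mem c hxW))

end IsNullLine

/-- The intersection graph of the null lines of a trilinear form. -/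
def nullLineGraph (T : V →ₗ[ℝ] V →ₗ[ℝ] V →ₗ[ℝ] ℝ) :
    SimpleGraph {W : Submodule ℝ V // IsNullLine T W} where
  Adj a b := a ≠ b ∧ a.1 ⊓ b.1 ≠ ⊥
  symm := ⟨fun a b hab => ⟨hab.1.symm, by rw [inf_comm]; exact hab.2⟩⟩
  loopless := ⟨fun a h => h.1 rfl⟩

theorem nullLineGraph_third (h : IsSmoothTrilinear T) {a b : {W : Submodule ℝ V // IsNullLine T W}}
    (hab : (nullLineGraph T).Adj a b) :
    ∃ c, IsTritangent (nullLineGraph T) a b c ∧ c.1 ≤ a.1 ⊔ b.1 ∧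
      ∀ d : {W : Submodule ℝ V // IsNullLine T W}, d.1 ≤ a.1 ⊔ b.1 → d = a ∨ d = b ∨ d = c := by
  have := h.finiteDimensional
  have hne : a.1 ≠ b.1 := fun e => hab.1 (Subtype.ext e)
  obtain ⟨p, hp₁, hp₂, hp0⟩ := inf_ne_bot_iff.1 hab.2
  have hP := finrank_sup_eq_three a.2.finrank_eq b.2.finrank_eq hne hp₁ hp₂ hp0
  obtain ⟨W₃, h₃, hle, h31, h32, hmeet, hall⟩ :=
    a.2.exists_third_of_inf_ne_bot h b.2 hne hab.2
  have hall' : ∀ d : {W : Submodule ℝ V // IsNullLine T W},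
      d.1 ≤ a.1 ⊔ b.1 → d = a ∨ d = b ∨ d = ⟨W₃, h₃⟩ := fun d hd => by
    simpa [Subtype.ext_iff] using hall d.1 d.2 hd
  refine ⟨⟨W₃, h₃⟩, ⟨hab, ⟨fun e => h31 (congrArg Subtype.val e).symm, ?_⟩,
    ⟨fun e => h32 (congrArg Subtype.val e).symm, ?_⟩, fun d hda hdb hdc => ?_⟩, hle, hall'⟩
  · exact inf_ne_bot_of_le a.2.finrank_eq h₃.finrank_eq hP le_sup_left hle
  · exact inf_ne_bot_of_le b.2.finrank_eq h₃.finrank_eq hP le_sup_right hle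
  · have hdP : ¬d.1 ≤ a.1 ⊔ b.1 := fun hd => by
      rcases hall' d hd with e | e | e
      exacts [hda e, hdb e, hdc e]
    have hab' := a.2.not_meet_both h b.2 d.2 hne le_sup_left le_sup_right hdP
    have hac' := a.2.not_meet_both h h₃ d.2 h31.symm le_sup_left hle hdP
    have hbc' := b.2.not_meet_both h h₃ d.2 h32.symm le_sup_right hle hdP
    obtain ⟨x, hxd, hx0, hx⟩ := hmeet d.1 d.2
    have hadj : ∀ {e x}, d ≠ e → x ∈ d.1 → x ∈ e.1 → x ≠ 0 → (nullLineGraph T).Adj d e :=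
      fun hde hxd hxe hx0 => ⟨hde, inf_ne_bot_iff.2 ⟨_, hxd, hxe, hx0⟩⟩
    rcases hx with hx | hx | hx
    · have had := hadj hda hxd hx hx0
      exact .inl ⟨had, fun h' => hab' had.2 h'.2, fun h' => hac' had.2 h'.2⟩
    · have hbd := hadj hdb hxd hx hx0
      exact .inr (.inl ⟨fun h' => hab' h'.2 hbd.2, hbd, fun h' => hbc' hbd.2 h'.2⟩)
    · have hcd := hadj (e := ⟨W₃, h₃⟩) hdc hxd hx hx0
      exact .inr (.inr ⟨fun h' => hac' h'.2 hcd.2, fun h' => hbc' h'.2 hcd.2, hcd⟩)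

theorem ncard_neighborSet_le_and (h : IsSmoothTrilinear T)
    [Finite {W : Submodule ℝ V // IsNullLine T W}] (a : {W : Submodule ℝ V // IsNullLine T W}) :
    ((nullLineGraph T).neighborSet a).ncard ≤ 10 ∧
      ((∀ v, v ≠ a → (nullLineGraph T).Adj a v) ∨
        ((nullLineGraph T).neighborSet a).ncard ∈ ({2, 6, 10} : Set ℕ)) := by
  classical
  have := h.finiteDimensional
  obtain ⟨p, u, n, g, hF, hD, ha⟩ := a.2.exists_frame h
  let S := IsFrame.singularParams T p u n g
  let P : ℝ → Submodule ℝ V := fun t => Submodule.span ℝ {p, u, n + t • g}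
  have hP : ∀ t, finrank ℝ (P t) = 3 := fun t => (hF.add_smul t).finrank_plane
  have haP : ∀ t, a.1 ≤ P t := fun t => by
    rw [← ha]; exact Submodule.span_mono (by grind)
  have hfin := Set.toFinite ((nullLineGraph T).neighborSet a)
  have hadj : ∀ {b t}, b ≠ a → b.1 ≤ P t → (nullLineGraph T).Adj a b := fun {b _} hb hbP =>
    ⟨hb.symm, inf_ne_bot_of_le a.2.finrank_eq b.2.finrank_eq (hP _) (haP _) hbP⟩
  let fibre : ℝ → Finset {W : Submodule ℝ V // IsNullLine T W} := fun t =>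
    hfin.toFinset.filter fun b => b.1 ≤ P t
  have hfibre : ∀ {t b}, b ∈ fibre t ↔ b ≠ a ∧ b.1 ≤ P t := fun {t b} => by
    simp only [fibre, Finset.mem_filter, Set.Finite.mem_toFinset, SimpleGraph.mem_neighborSet]
    exact ⟨fun hb => ⟨hb.1.1.symm, hb.2⟩, fun hb => ⟨hadj hb.1 hb.2, hb.2⟩⟩
  have hcard : ∀ t, (fibre t).Nonempty → (fibre t).card = 2 := fun t ⟨b, hb⟩ => by
    obtain ⟨hba, hbP⟩ := hfibre.1 hb
    obtain ⟨c, hc, hcP, hall⟩ := nullLineGraph_third h (hadj hba hbP)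
    have hsup : a.1 ⊔ b.1 = P t := by
      obtain ⟨x, hxa, hxb, hx0⟩ := inf_ne_bot_iff.1 (hadj hba hbP).2
      refine Submodule.eq_of_le_of_finrank_eq (sup_le (haP t) hbP) ?_
      rw [hP, finrank_sup_eq_three a.2.finrank_eq b.2.finrank_eq
        (fun e => hba (Subtype.ext e).symm) hxa hxb hx0]
    rw [hsup] at hcP hall
    have : fibre t = {b, c} := by
      ext d
      rw [hfibre, Finset.mem_insert, Finset.mem_singleton]
      constructor
      · exact fun hd => (hall d hd.2).resolve_left hd.1
      · rintro (rfl | rfl)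
        exacts [⟨hba, hbP⟩, ⟨hc.adj₁₃.1.symm, hcP⟩]
    rw [this, Finset.card_pair hc.adj₂₃.1]
  have hunion : hfin.toFinset = S.biUnion fibre := by
    ext b
    simp only [Set.Finite.mem_toFinset, SimpleGraph.mem_neighborSet, Finset.mem_biUnion, hfibre]
    constructor
    · intro hb
      obtain ⟨t, ht, hbt⟩ := hF.exists_param h hD b.2
        (by rw [ha]; exact fun e => hb.1 (Subtype.ext e).symm)
        (by rw [ha, inf_comm]; exact hb.2)
      exact ⟨t, ht, hb.1.symm, hbt⟩
    · rintro ⟨t, -, hb, hbP⟩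
      exact hadj hb hbP
  have hsum : ((nullLineGraph T).neighborSet a).ncard = ∑ t ∈ S, (fibre t).card := by
    rw [Set.ncard_eq_toFinset_card _ hfin, hunion, Finset.card_biUnion]
    refine fun s _ t _ hst => Finset.disjoint_left.2 fun b hbs hbt => hst ?_
    rw [hfibre] at hbs hbt
    exact hF.param_unique b.2.finrank_eq
      (by rw [ha]; exact fun e => hbs.1 (Subtype.ext e)) hbs.2 hbt.2
  have hS := IsFrame.card_singularParams h hF hD
  have hle : ∑ t ∈ S, (fibre t).card ≤ S.card • 2 := Finset.sum_le_card_nsmul _ _ _ fun t _ => by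
    rcases (fibre t).eq_empty_or_nonempty with e | e
    · simp [e]
    · exact (hcard t e).le
  rw [hsum]
  simp only [Set.mem_insert_iff, Set.mem_singleton_iff, smul_eq_mul] at hS hle ⊢
  change S.card = 1 ∨ S.card = 3 ∨ S.card = 5 at hS
  refine ⟨by omega, ?_⟩
  by_cases hne : ∀ t ∈ S, (fibre t).Nonempty
  · right
    rw [Finset.sum_congr rfl fun t ht => hcard t (hne t ht), Finset.sum_const, smul_eq_mul]
    omega
  · left
    push Not at hne
    obtain ⟨t, ht, he⟩ := hne
    have := (hF.add_smul t).exists_null_or_forall_meet h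
      ((IsFrame.mem_singularParams h hD).1 ht)
    rw [ha] at this
    refine fun v hv => ⟨hv.symm, ?_⟩
    rw [inf_comm]
    refine this.resolve_left (fun ⟨W, hW, hWa, hWP⟩ => ?_) v.1 v.2
    exact (Finset.eq_empty_iff_forall_notMem.1 he ⟨W, hW⟩)
      (hfibre.2 ⟨fun e => hWa (congrArg Subtype.val e), hWP⟩)

theorem isCubicLineGraph_nullLineGraph (h : IsSmoothTrilinear T)
    [Finite {W : Submodule ℝ V // IsNullLine T W}] : IsCubicLineGraph (nullLineGraph T) where
  third _ _ hab := (nullLineGraph_third h hab).imp fun _ hc => hc.1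
  degree_le a := (ncard_neighborSet_le_and h a).1
  universal_or_degree a := (ncard_neighborSet_le_and h a).2

/-- Smooth trilinear forms with equally many null lines have isomorphic intersection graphs. -/
theorem exists_equiv_nullLine {V' : Type*} [AddCommGroup V'] [Module ℝ V']
    {T' : V' →ₗ[ℝ] V' →ₗ[ℝ] V' →ₗ[ℝ] ℝ} (h : IsSmoothTrilinear T) (h' : IsSmoothTrilinear T')
    [Finite {W : Submodule ℝ V // IsNullLine T W}]
    [Finite {W : Submodule ℝ V' // IsNullLine T' W}]
    (hcard : Nat.card {W : Submodule ℝ V // IsNullLine T W} =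
      Nat.card {W : Submodule ℝ V' // IsNullLine T' W}) :
    ∃ σ : {W : Submodule ℝ V // IsNullLine T W} ≃ {W : Submodule ℝ V' // IsNullLine T' W},
      ∀ a b, a.1 ⊓ b.1 ≠ ⊥ ↔ (σ a).1 ⊓ (σ b).1 ≠ ⊥ := by
  obtain ⟨σ, hσ⟩ := (isCubicLineGraph_nullLineGraph h).exists_equiv
    (isCubicLineGraph_nullLineGraph h') hcard
  refine ⟨σ, fun a b => ?_⟩
  rcases eq_or_ne a b with rfl | hab
  · simpa only [inf_idem] using iff_of_true a.2.ne_bot (σ a).2.ne_bot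
  · simpa [nullLineGraph, hab] using hσ a b

end NullLineGraph

section PolarForm

theorem pderiv_pderiv_comm {σ R : Type*} [CommRing R] (i j : σ) (f : MvPolynomial σ R) :
    pderiv i (pderiv j f) = pderiv j (pderiv i f) := by
  classical
  induction f using MvPolynomial.induction_on with
  | C a => simp
  | add p q hp hq => simp only [map_add, hp, hq]
  | mul_X p k hp =>
    simp only [Derivation.leibniz, map_add, smul_eq_mul, pderiv_X, hp]
    rcases eq_or_ne k i with rfl | hi <;> rcases eq_or_ne k j with rfl | hj <;>
      simp [*, add_comm]

/-- The coefficients of the polar form of a cubic form. -/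
noncomputable def polarCoeff (f : MvPolynomial (Fin 4) ℝ) (i j k : Fin 4) : ℝ :=
  coeff 0 (pderiv i (pderiv j (pderiv k f))) / 6

variable {f : MvPolynomial (Fin 4) ℝ}

theorem polarCoeff_swap₁₂ (i j k : Fin 4) : polarCoeff f i j k = polarCoeff f j i k := by
  rw [polarCoeff, polarCoeff, pderiv_pderiv_comm]

theorem polarCoeff_swap₂₃ (i j k : Fin 4) : polarCoeff f i j k = polarCoeff f i k j := by
  rw [polarCoeff, polarCoeff, pderiv_pderiv_comm j k]

/-- The symmetric trilinear form `T` with `T x x x = f x`, for a cubic form `f`. -/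
noncomputable def polarForm (f : MvPolynomial (Fin 4) ℝ) :
    (Fin 4 → ℝ) →ₗ[ℝ] (Fin 4 → ℝ) →ₗ[ℝ] (Fin 4 → ℝ) →ₗ[ℝ] ℝ :=
  ∑ i, ∑ j, ∑ k, polarCoeff f i j k •
    (LinearMap.proj i).smulRight ((LinearMap.proj j).smulRight (LinearMap.proj k))

theorem polarForm_apply (u v w : Fin 4 → ℝ) :
    polarForm f u v w = ∑ i, ∑ j, ∑ k, polarCoeff f i j k * (u i * v j * w k) := by
  simp [polarForm, LinearMap.sum_apply, mul_assoc]

theorem polarForm_apply_single (u v : Fin 4 → ℝ) (k : Fin 4) :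
    polarForm f u v (Pi.single k 1) = ∑ i, ∑ j, polarCoeff f i j k * (u i * v j) := by
  simp [polarForm_apply, Pi.single_apply]

theorem polarForm_swap₁₂ (u v w : Fin 4 → ℝ) : polarForm f u v w = polarForm f v u w := by
  rw [polarForm_apply, polarForm_apply, Finset.sum_comm]
  refine Finset.sum_congr rfl fun i _ => Finset.sum_congr rfl fun j _ =>
    Finset.sum_congr rfl fun k _ => ?_
  rw [polarCoeff_swap₁₂, mul_comm (u j)]

theorem polarForm_swap₂₃ (u v w : Fin 4 → ℝ) : polarForm f u v w = polarForm f u w v := by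
  rw [polarForm_apply, polarForm_apply]
  refine Finset.sum_congr rfl fun i _ => ?_
  rw [Finset.sum_comm]
  refine Finset.sum_congr rfl fun j _ => Finset.sum_congr rfl fun k _ => ?_
  rw [polarCoeff_swap₂₃, mul_right_comm]

section Algebra

variable {A : Type*} [CommRing A] [Algebra ℝ A]

theorem sum_mul_aeval_pderiv {g : MvPolynomial (Fin 4) ℝ} {n : ℕ} (hg : g.IsHomogeneous n)
    (x : Fin 4 → A) : ∑ i, x i * aeval x (pderiv i g) = n * aeval x g := by
  simpa using congrArg (aeval x) hg.sum_X_mul_pderiv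

theorem aeval_pderiv_eq_sum (hf : f.IsHomogeneous 3) (x : Fin 4 → A) (k : Fin 4) :
    aeval x (pderiv k f) =
      3 * ∑ i, ∑ j, algebraMap ℝ A (polarCoeff f i j k) * (x i * x j) := by
  have h₂ : ∀ i j, aeval x (pderiv i (pderiv j (pderiv k f))) =
      6 * algebraMap ℝ A (polarCoeff f i j k) := fun i j => by
    have h0 : (pderiv i (pderiv j (pderiv k f))).IsHomogeneous 0 := hf.pderiv.pderiv.pderiv
    rw [← totalDegree_zero_iff_isHomogeneous, totalDegree_eq_zero_iff_eq_C] at h0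
    rw [h0, aeval_C, polarCoeff, ← map_ofNat (algebraMap ℝ A) 6, ← map_mul,
      mul_div_cancel₀ _ (by norm_num)]
  have h₁ : ∀ j, aeval x (pderiv j (pderiv k f)) =
      ∑ i, x i * (6 * algebraMap ℝ A (polarCoeff f i j k)) := fun j => by
    have := sum_mul_aeval_pderiv (hf.pderiv (i := k)).pderiv (x := x) (g := pderiv j (pderiv k f))
    simp only [h₂] at this
    simpa using this.symm
  have h := sum_mul_aeval_pderiv (hf.pderiv (i := k)) x
  simp only [h₁] at h
  rw [Finset.sum_comm' (t' := Finset.univ) (s' := fun _ => Finset.univ) (by simp)]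
  have h2 : IsUnit (2 : A) := by
    simpa only [map_ofNat] using (IsUnit.mk0 (2 : ℝ) two_ne_zero).map (algebraMap ℝ A)
  refine h2.mul_left_cancel ?_
  norm_num at h
  rw [← h, Finset.mul_sum, Finset.mul_sum]
  refine Finset.sum_congr rfl fun j _ => ?_
  rw [Finset.mul_sum, Finset.mul_sum, Finset.mul_sum]
  exact Finset.sum_congr rfl fun i _ => by ring

end Algebra

theorem eval_eq_polarForm (hf : f.IsHomogeneous 3) (x : Fin 4 → ℝ) :
    eval x f = polarForm f x x x := by
  have h := sum_mul_aeval_pderiv hf x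
  simp only [aeval_pderiv_eq_sum hf, Algebra.algebraMap_self, RingHom.id_apply,
    ← polarForm_apply_single] at h
  have h1 : ∑ k, x k * polarForm f x x (Pi.single k 1) = polarForm f x x x := by
    conv_rhs => rw [polarForm_apply]
    simp_rw [polarForm_apply_single, Finset.mul_sum]
    rw [Finset.sum_comm]
    refine Finset.sum_congr rfl fun i _ => ?_
    rw [Finset.sum_comm]
    exact Finset.sum_congr rfl fun j _ => Finset.sum_congr rfl fun k _ => by ring
  have h2 : ∑ k, x k * (3 * polarForm f x x (Pi.single k 1)) = 3 * polarForm f x x x := by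
    rw [← h1, Finset.mul_sum]
    exact Finset.sum_congr rfl fun i _ => by ring
  rw [h2, aeval_eq_eval, Nat.cast_ofNat] at h
  linarith

theorem isSmoothTrilinear_polarForm (hf : IsSmoothCubic ℝ f) :
    IsSmoothTrilinear (polarForm f) where
  finrank_eq := by simp
  swap₁₂ := polarForm_swap₁₂
  swap₂₃ := polarForm_swap₂₃
  smooth u v h₁ h₂ := by
    obtain ⟨-, hf3, hs⟩ := hf
    let a := algebraMap ℝ (AlgebraicClosure ℝ)
    obtain ⟨I, hI⟩ := IsAlgClosed.exists_pow_nat_eq (-1 : AlgebraicClosure ℝ) (n := 2) two_pos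
    let x : Fin 4 → AlgebraicClosure ℝ := fun i => a (u i) + I * a (v i)
    have hd : ∀ k, aeval x (pderiv k f) = 0 := fun k => by
      have key : ∑ i, ∑ j, a (polarCoeff f i j k) * (x i * x j) =
          a (polarForm f u u (Pi.single k 1)) + I * a (polarForm f u v (Pi.single k 1)) +
          I * a (polarForm f v u (Pi.single k 1)) - a (polarForm f v v (Pi.single k 1)) := by
        simp only [polarForm_apply_single, map_sum, Finset.mul_sum, ← Finset.sum_add_distrib,
          ← Finset.sum_sub_distrib, map_mul, x]
        refine Finset.sum_congr rfl fun i _ => Finset.sum_congr rfl fun j _ => ?_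
        linear_combination a (polarCoeff f i j k) * a (v i) * a (v j) * hI
      rw [aeval_pderiv_eq_sum hf3, key, polarForm_swap₁₂ v u, h₁, h₂]
      simp
    have hx : x = 0 := by
      refine hs x ⟨?_, fun i => ?_⟩
      · have := sum_mul_aeval_pderiv hf3 x
        simpa [hd, eval_map, aeval_def] using this.symm
      · rw [eval_map, ← aeval_def, hd]
    have huv : ∀ i, u i = 0 ∧ v i = 0 := fun i => by
      have h : a (u i) + I * a (v i) = 0 := congrFun hx i
      have h' : a (u i ^ 2 + v i ^ 2) = 0 := by
        rw [map_add, map_pow, map_pow]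
        linear_combination (a (u i) - I * a (v i)) * h + a (v i) ^ 2 * hI
      have := (map_eq_zero a).1 h'
      constructor <;> nlinarith [sq_nonneg (u i), sq_nonneg (v i)]
    exact ⟨funext fun i => (huv i).1, funext fun i => (huv i).2⟩

theorem eval_lineRestrict (v w : Fin 4 → ℝ) (y : Fin 2 → ℝ) :
    eval y (lineRestrict f v w) = eval (y 0 • v + y 1 • w) f := by
  rw [lineRestrict, ← coe_aeval_eq_eval, ← coe_aeval_eq_eval]
  simp only [RingHom.coe_coe]
  rw [← AlgHom.comp_apply, comp_aeval]
  congr 2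
  ext i
  simp [mul_comm]

theorem isLineOn_iff (hf : f.IsHomogeneous 3) {W : Submodule ℝ (Fin 4 → ℝ)} :
    IsLineOn f W ↔ IsNullLine (polarForm f) W := by
  constructor
  · rintro ⟨hW, v, w, rfl, h⟩
    refine ⟨hW, fun x hx => ?_⟩
    obtain ⟨s, t, rfl⟩ := Submodule.mem_span_pair.1 hx
    rw [← eval_eq_polarForm hf]
    simpa [h] using (eval_lineRestrict (f := f) v w ![s, t]).symm
  · intro h
    obtain ⟨p, hp, hp0⟩ := Submodule.exists_mem_ne_zero_of_ne_bot h.ne_bot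
    obtain ⟨u, hu, -, rfl⟩ := exists_pair_of_mem h.finrank_eq hp hp0
    refine ⟨h.finrank_eq, p, u, rfl, MvPolynomial.funext fun y => ?_⟩
    rw [eval_lineRestrict, eval_eq_polarForm hf, map_zero]
    exact h.null _ (add_mem (Submodule.smul_mem _ _ hp) (Submodule.smul_mem _ _ hu))

end PolarForm

/-- two real smooth cubic surfaces with the same finite number of real
lines have isomorphic intersection graphs. -/
theorem real_cubics_same_line_count_isomorphic_graphs
    (f f' : MvPolynomial (Fin 4) ℝ)
    (hf : IsSmoothCubic ℝ f) (hf' : IsSmoothCubic ℝ f')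
    (hfin : {W : Submodule ℝ (Fin 4 → ℝ) | IsLineOn f W}.Finite)
    (hfin' : {W : Submodule ℝ (Fin 4 → ℝ) | IsLineOn f' W}.Finite)
    (hcard : {W : Submodule ℝ (Fin 4 → ℝ) | IsLineOn f W}.ncard =
      {W : Submodule ℝ (Fin 4 → ℝ) | IsLineOn f' W}.ncard) :
    ∃ σ : {W : Submodule ℝ (Fin 4 → ℝ) // IsLineOn f W} ≃
        {W : Submodule ℝ (Fin 4 → ℝ) // IsLineOn f' W},
      ∀ W₁ W₂ : {W : Submodule ℝ (Fin 4 → ℝ) // IsLineOn f W},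
        ((W₁ : Submodule ℝ (Fin 4 → ℝ)) ⊓ (W₂ : Submodule ℝ (Fin 4 → ℝ)) ≠ ⊥ ↔
          ((σ W₁ : Submodule ℝ (Fin 4 → ℝ)) ⊓ (σ W₂ : Submodule ℝ (Fin 4 → ℝ)) ≠ ⊥)) := by
  have hL : IsLineOn f = IsNullLine (polarForm f) :=
    funext fun W => propext (isLineOn_iff hf.2.1)
  have hL' : IsLineOn f' = IsNullLine (polarForm f') :=
    funext fun W => propext (isLineOn_iff hf'.2.1)
  rw [hL] at hfin hcard ⊢
  rw [hL'] at hfin' hcard ⊢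
  have : Finite {W // IsNullLine (polarForm f) W} := hfin.to_subtype
  have : Finite {W // IsNullLine (polarForm f') W} := hfin'.to_subtype
  exact exists_equiv_nullLine (isSmoothTrilinear_polarForm hf) (isSmoothTrilinear_polarForm hf')
    hcard
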